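/- arXiv:2404.08400 — 3 statements merged into one kernel-verified Lean document; each statement's English description precedes it below -/
import Mathlib

section
/- Let T be a tree of order m with diameter d ≥ 2, let ε = ε(T), and let K_n be the complete graph on n ≥ 2 vertices. Suppose there exists an ordering w_0, w_1, ..., w_{mn−1} of V(T □ K_n), with w_t = (u_{i_t}, v_{j_t}), such that: (a) L(u_{i_0}) = L(u_{i_{mn−1}}) = 0; (b) v_{j_t} and v_{j_{t+1}} are distinct for all 0 ≤ t ≤ mn−2; (c) u_{i_t} and u_{i_{t+1}} are in different branches when |W(T)| = 1 and in opposite branches when |W(T)| = 2, for all 0 ≤ t ≤ mn−2; and (d) min{d(u_{i_t}, u_{i_{t+1}}), d(u_{i_{t+1}}, u_{i_{t+2}})} ≤ (d + 1 − ε)/2 for all 0 ≤ t ≤ mn−3. Then rn(T □ K_n) = (mn − 1)(d + ε) − 2nL(T). -/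
open SimpleGraph Finset

namespace RadioPaper

/-- A radio labelling of `G`: `|f u - f v| ≥ diam G + 1 - d(u,v)` for all distinct `u v`. -/
def IsRadioLabelling {α : Type*} [Fintype α] (G : SimpleGraph α) (f : α → ℕ) : Prop :=
  ∀ u v : α, u ≠ v → G.diam + 1 ≤ Nat.dist (f u) (f v) + G.dist u v

/-- The span of a labelling: the maximum difference between two labels. -/
noncomputable def spanOf {α : Type*} [Fintype α] (f : α → ℕ) : ℕ :=
  Finset.univ.sup fun p : α × α => Nat.dist (f p.1) (f p.2)

/-- The radio number of `G`: the minimum span of a radio labelling of `G`. -/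
noncomputable def radioNumber {α : Type*} [Fintype α] (G : SimpleGraph α) : ℕ :=
  sInf { k | ∃ f : α → ℕ, IsRadioLabelling G f ∧ spanOf f = k }

variable {V : Type*} [Fintype V]

/-- The weight of `G` from `v`. -/
noncomputable def weight (G : SimpleGraph V) (v : V) : ℕ := ∑ u, G.dist u v

/-- The set of weight centers: vertices minimizing the weight. -/
def weightCenters (G : SimpleGraph V) : Set V := {v | ∀ u, weight G v ≤ weight G u}

/-- The level of a vertex: its distance to the nearest weight center. -/
noncomputable def level (G : SimpleGraph V) (u : V) : ℕ :=
  sInf ((fun x => G.dist u x) '' weightCenters G)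

/-- The total level of `G`. -/
noncomputable def totalLevel (G : SimpleGraph V) : ℕ := ∑ u, level G u

/-- `ε(G) = 1` if `G` has a unique weight center, `0` otherwise. -/
noncomputable def epsilon (G : SimpleGraph V) : ℕ :=
  if (weightCenters G).ncard = 1 then 1 else 0

/-- `x` lies on a shortest (= unique, in a tree) path from `a` to `b`. -/
def onPath (G : SimpleGraph V) (a x b : V) : Prop :=
  G.dist a x + G.dist x b = G.dist a b

/-- `x` is a common ancestor of `u` and `v` (tree rooted at its weight centers). -/
def IsCommonAncestor (G : SimpleGraph V) (x u v : V) : Prop :=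
  (∃ w ∈ weightCenters G, onPath G w x u) ∧ ∃ w ∈ weightCenters G, onPath G w x v

/-- `φ(u,v)`: the maximum level of a common ancestor of `u` and `v`. -/
noncomputable def phi (G : SimpleGraph V) (u v : V) : ℕ :=
  sSup (level G '' {x | IsCommonAncestor G x u v})

open scoped Classical in
/-- `δ(u,v) = 1` iff `G` has two weight centers and the `(u,v)`-path contains both. -/
noncomputable def delta (G : SimpleGraph V) (u v : V) : ℕ :=
  if (weightCenters G).ncard = 2 ∧ ∀ x ∈ weightCenters G, onPath G u x v then 1 else 0

/-- `u` and `v` are in different branches: their path contains exactly one weight center. -/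
def InDifferentBranches (G : SimpleGraph V) (u v : V) : Prop :=
  {x ∈ weightCenters G | onPath G u x v}.ncard = 1

/-- `u` and `v` are in opposite branches: the tree has two weight centers and the
`(u,v)`-path contains both. -/
def InOppositeBranches (G : SimpleGraph V) (u v : V) : Prop :=
  (weightCenters G).ncard = 2 ∧ ∀ x ∈ weightCenters G, onPath G u x v

/-- `u` and `v` are in the same branch: their path contains no weight center. -/
def InSameBranch (G : SimpleGraph V) (u v : V) : Prop :=
  ∀ x ∈ weightCenters G, ¬ onPath G u x v


/-! ### Tree facts -/

/-- In a tree, two neighbours of `z` which are both closer to `u` than `z` coincide. -/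
lemma tree_closer_unique {V : Type*} {T : SimpleGraph V} (hT : T.IsTree) {u z x y : V}
    (hx : T.Adj z x) (hy : T.Adj z y) (hdx : T.dist u z = T.dist u x + 1)
    (hdy : T.dist u z = T.dist u y + 1) : x = y := by
  have key : ∀ x, T.Adj z x → T.dist u z = T.dist u x + 1 →
      ∀ p : T.Walk u z, p.IsPath → x ∈ p.support := by
    intro x hx hdx p hp
    obtain ⟨q, hq, hq'⟩ := hT.connected.exists_path_of_dist u x
    refine hT.isAcyclic.mem_support_of_ne_mem_support_of_adj_of_isPath hp hq hx ?_
    intro hz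
    classical
    have h1 := T.dist_le (q.takeUntil z hz)
    have h2 := q.length_takeUntil_le_length hz
    omega
  obtain ⟨p, hp, -⟩ := hT.connected.exists_path_of_dist u z
  rw [hT.isAcyclic.eq_penultimate_of_adj_end hp hx (key x hx hdx p hp),
    hT.isAcyclic.eq_penultimate_of_adj_end hp hy (key y hy hdy p hp)]

/-- A neighbour one step closer to `v`. -/
lemma exists_step {V : Type*} {T : SimpleGraph V} (hT : T.IsTree) {b v : V} {k : ℕ}
    (h : T.dist v b = k + 1) : ∃ c, T.Adj b c ∧ T.dist v c = k := by
  obtain ⟨p, hp, hp'⟩ := hT.connected.exists_path_of_dist b v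
  rw [T.dist_comm, h] at hp'
  cases p with
  | nil => simp at hp'
  | cons hadj q =>
    rename_i c
    refine ⟨c, hadj, ?_⟩
    simp only [Walk.length_cons] at hp'
    have h1 := T.dist_le q
    have h2 := hT.connected.dist_triangle (u := v) (v := c) (w := b)
    rw [dist_eq_one_iff_adj.2 hadj.symm] at h2
    rw [T.dist_comm] at h1
    omega

lemma dist_across {V : Type*} {T : SimpleGraph V} (hT : T.IsTree) (u v : V) (k : ℕ) :
    ∀ a b, T.Adj a b → T.dist u b = T.dist u a + 1 → T.dist v a = T.dist v b + 1 →
      T.dist v b = k → T.dist u v = T.dist u a + 1 + k := by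
  induction k with
  | zero =>
    intro a b hab h1 h2 h3
    rw [hT.connected.dist_eq_zero_iff] at h3
    subst h3; omega
  | succ k ih =>
    intro a b hab h1 h2 h3
    obtain ⟨c, hbc, hc⟩ := exists_step hT h3
    have hcu : T.dist u c = T.dist u b + 1 := by
      rcases hT.dist_eq_dist_add_one_of_adj u hbc with h | h
      · have := tree_closer_unique hT hab.symm hbc h1 h
        subst this; omega
      · exact h
    have := ih b c hbc hcu (by omega) hc
    omega

lemma weight_convex {V : Type*} [Fintype V] {T : SimpleGraph V} (hT : T.IsTree) {a b c : V}
    (hab : T.Adj b a) (hbc : T.Adj b c) (hne : a ≠ c) :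
    2 * weight T b < weight T a + weight T c := by
  unfold weight
  rw [← Finset.sum_add_distrib, Finset.mul_sum]
  refine Finset.sum_lt_sum (fun u _ => ?_) ⟨b, Finset.mem_univ _, ?_⟩
  · rcases hT.dist_eq_dist_add_one_of_adj u hab with h | h <;>
    rcases hT.dist_eq_dist_add_one_of_adj u hbc with h' | h' <;> try omega
    exact absurd (tree_closer_unique hT hab hbc h h') hne
  · rw [dist_eq_one_iff_adj.2 hab, dist_eq_one_iff_adj.2 hbc]; simp

lemma weight_lt_along {V : Type*} [Fintype V] {T : SimpleGraph V} (hT : T.IsTree) (v : V) (k : ℕ) :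
    ∀ a b, T.Adj a b → weight T a ≤ weight T b → T.dist v a = T.dist v b + 1 →
      T.dist v b = k + 1 → weight T a < weight T v := by
  induction k with
  | zero =>
    intro a b hab h1 h2 h3
    have hbv : T.Adj b v := (dist_eq_one_iff_adj.1 h3).symm
    have : a ≠ v := by rintro rfl; simp at h2
    have := weight_convex hT hab.symm hbv this
    omega
  | succ k ih =>
    intro a b hab h1 h2 h3
    obtain ⟨c, hbc, hc⟩ := exists_step hT h3
    have : a ≠ c := by rintro rfl; omega
    have := weight_convex hT hab.symm hbc this
    have := ih b c hbc (by omega) (by omega) hc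
    omega

lemma centers_adj {V : Type*} [Fintype V] {T : SimpleGraph V} (hT : T.IsTree) {x y : V}
    (hx : x ∈ weightCenters T) (hy : y ∈ weightCenters T) (hne : x ≠ y) : T.Adj x y := by
  by_contra hadj
  have h2 := hT.connected.one_lt_dist_of_ne_of_not_adj hne hadj
  rw [T.dist_comm] at h2
  obtain ⟨k, hk⟩ : ∃ k, T.dist y x = k + 1 + 1 := ⟨T.dist y x - 2, by omega⟩
  obtain ⟨c, hc, hc'⟩ := exists_step hT hk
  have := weight_lt_along hT y k x c hc (hx c) (by omega) hc'
  have := hy x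
  omega

lemma centers_cases {V : Type*} [Fintype V] {T : SimpleGraph V} (hT : T.IsTree) :
    (∃ c, weightCenters T = {c}) ∨ (∃ a b, T.Adj a b ∧ weightCenters T = {a, b}) := by
  have := hT.connected.nonempty
  obtain ⟨a, ha⟩ := Finite.exists_min (weight T)
  have ha : a ∈ weightCenters T := ha
  by_cases h : ∃ b ∈ weightCenters T, b ≠ a
  · obtain ⟨b, hb, hne⟩ := h
    right
    have hab := centers_adj hT ha hb hne.symm
    refine ⟨a, b, hab, Set.Subset.antisymm ?_ ?_⟩
    · intro c hc
      by_contra hcc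
      simp only [Set.mem_insert_iff, Set.mem_singleton_iff, not_or] at hcc
      have h1 := centers_adj hT hc ha hcc.1
      have h2 := centers_adj hT hc hb hcc.2
      refine hT.dist_ne_of_adj c hab ?_
      rw [dist_eq_one_iff_adj.2 h1, dist_eq_one_iff_adj.2 h2]
    · rintro c (rfl | rfl) <;> assumption
  · left
    push Not at h
    exact ⟨a, Set.Subset.antisymm (fun b hb => h b hb) (by rintro _ rfl; exact ha)⟩

lemma level_one {V : Type*} [Fintype V] {T : SimpleGraph V} {c : V} (h : weightCenters T = {c})
    (u : V) : level T u = T.dist u c := by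
  simp [level, h]

lemma level_two {V : Type*} [Fintype V] {T : SimpleGraph V} {a b : V}
    (h : weightCenters T = {a, b}) (u : V) :
    level T u = min (T.dist u a) (T.dist u b) := by
  simp only [level, h, Set.image_pair]
  exact csInf_pair _ _

lemma epsilon_one {V : Type*} [Fintype V] {T : SimpleGraph V} {c : V} (h : weightCenters T = {c}) :
    epsilon T = 1 := by simp [epsilon, h]

lemma ncard_two {V : Type*} [Fintype V] {T : SimpleGraph V} {a b : V} (hab : T.Adj a b)
    (h : weightCenters T = {a, b}) : (weightCenters T).ncard = 2 := by
  rw [h, Set.ncard_pair hab.ne]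

lemma epsilon_two {V : Type*} [Fintype V] {T : SimpleGraph V} {a b : V} (hab : T.Adj a b)
    (h : weightCenters T = {a, b}) : epsilon T = 0 := by
  simp [epsilon, ncard_two hab h]

lemma dist_le_levels {V : Type*} [Fintype V] {T : SimpleGraph V} (hT : T.IsTree) (u v : V) :
    T.dist u v + epsilon T ≤ level T u + level T v + 1 := by
  rcases centers_cases hT with ⟨c, hc⟩ | ⟨a, b, hab, hc⟩
  · rw [epsilon_one hc, level_one hc, level_one hc]
    have := hT.connected.dist_triangle (u := u) (v := c) (w := v)
    rw [T.dist_comm (u := c)] at this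
    omega
  · rw [epsilon_two hab hc, level_two hc, level_two hc]
    have h1 := hT.connected.dist_triangle (u := u) (v := a) (w := v)
    have h2 := hT.connected.dist_triangle (u := u) (v := b) (w := v)
    have h3 := hT.dist_eq_dist_add_one_of_adj u hab
    have h4 := hT.dist_eq_dist_add_one_of_adj v hab
    rw [T.dist_comm (u := a)] at h1
    rw [T.dist_comm (u := b)] at h2
    omega

/-! ### The product -/

lemma conn_prod {V : Type*} {T : SimpleGraph V} (hT : T.IsTree) {n : ℕ} (hn : 2 ≤ n) :
    (T □ (⊤ : SimpleGraph (Fin n))).Connected := by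
  have : Nonempty (Fin n) := ⟨⟨0, by omega⟩⟩
  exact hT.connected.boxProd connected_top

lemma dist_prod {V : Type*} {T : SimpleGraph V} (hT : T.IsTree) {n : ℕ} (hn : 2 ≤ n)
    (x y : V × Fin n) : (T □ (⊤ : SimpleGraph (Fin n))).dist x y =
      T.dist x.1 y.1 + if x.2 = y.2 then 0 else 1 := by
  have : Nonempty (Fin n) := ⟨⟨0, by omega⟩⟩
  have h := edist_boxProd (G := T) (H := (⊤ : SimpleGraph (Fin n))) x y
  rw [← dist_top, ← ((conn_prod hT hn) x y).coe_dist_eq_edist,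
    ← (hT.connected x.1 y.1).coe_dist_eq_edist,
    ← ((connected_top (V := Fin n)) x.2 y.2).coe_dist_eq_edist] at *
  exact_mod_cast h

lemma dist_le_diam' {V : Type*} [Finite V] {T : SimpleGraph V} (hT : T.Connected) (u v : V) :
    T.dist u v ≤ T.diam := by
  have := hT.nonempty
  exact dist_le_diam (connected_iff_ediam_ne_top.1 hT)

lemma diam_prod {V : Type*} [Finite V] {T : SimpleGraph V} (hT : T.IsTree) {n : ℕ} (hn : 2 ≤ n) :
    (T □ (⊤ : SimpleGraph (Fin n))).diam = T.diam + 1 := by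
  have := hT.connected.nonempty
  have : Nonempty (Fin n) := ⟨⟨0, by omega⟩⟩
  apply le_antisymm
  · obtain ⟨x, y, h⟩ := exists_dist_eq_diam (G := (T □ (⊤ : SimpleGraph (Fin n))))
    rw [← h, dist_prod hT hn]
    have := dist_le_diam' hT.connected x.1 y.1
    split_ifs <;> omega
  · obtain ⟨x, y, h⟩ := exists_dist_eq_diam (G := T)
    have := dist_le_diam' (conn_prod hT hn) (x, ⟨0, by omega⟩) (y, ⟨1, by omega⟩)
    rw [dist_prod hT hn] at this
    simp at this
    omega

/-! ### Sums along an ordering -/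

lemma sum_ordering {α : Type*} [Fintype α] {N : ℕ} {w : ℕ → α}
    (hw : Set.BijOn w (Set.Iio N) Set.univ) (F : α → ℤ) :
    ∑ i ∈ Finset.range N, F (w i) = ∑ p, F p := by
  refine Finset.sum_nbij w (by simp) ?_ ?_ (by simp)
  · rw [Finset.coe_range]; exact hw.injOn
  · rw [Finset.coe_range, Finset.coe_univ]; exact hw.surjOn

lemma sum_level_ordering {V : Type*} [Fintype V] (T : SimpleGraph V) {n N : ℕ}
    {w : ℕ → V × Fin n} (hw : Set.BijOn w (Set.Iio N) Set.univ) :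
    ∑ i ∈ Finset.range N, (level T (w i).1 : ℤ) = n * totalLevel T := by
  rw [sum_ordering hw (fun p => (level T p.1 : ℤ)), Fintype.sum_prod_type]
  simp [totalLevel, Finset.mul_sum]

lemma sum_telescope (D : ℤ) (l : ℕ → ℤ) (k : ℕ) :
    ∑ i ∈ Finset.range k, (D - l i - l (i + 1)) =
      k * D - 2 * ∑ i ∈ Finset.range (k + 1), l i + l 0 + l k := by
  induction k with
  | zero => simp; ring
  | succ k ih =>
    rw [Finset.sum_range_succ, ih, Finset.sum_range_succ _ (k + 1)]
    push_cast; ring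

lemma exists_sorted {α : Type*} [Fintype α] [Inhabited α] (f : α → ℕ) :
    ∃ x : ℕ → α, Set.BijOn x (Set.Iio (Fintype.card α)) Set.univ ∧
      ∀ i j, i ≤ j → j < Fintype.card α → f (x i) ≤ f (x j) := by
  classical
  let e0 := (Fintype.equivFin α).symm
  let σ := Tuple.sort (f ∘ e0)
  have hmono : Monotone ((f ∘ e0) ∘ σ) := Tuple.monotone_sort _
  refine ⟨fun i => if h : i < Fintype.card α then e0 (σ ⟨i, h⟩) else default,
    ⟨fun _ _ => Set.mem_univ _, ?_, ?_⟩, ?_⟩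
  · intro i hi j hj hij
    simp only [Set.mem_Iio] at hi hj
    simp only [hi, hj, dif_pos] at hij
    simpa using σ.injective (e0.injective hij)
  · intro a _
    refine ⟨(σ.symm (e0.symm a)).1, (σ.symm (e0.symm a)).2, ?_⟩
    simp
  · intro i j hij hj
    have hi : i < Fintype.card α := lt_of_le_of_lt hij hj
    simp only [hi, hj, dif_pos]
    exact hmono (show (⟨i, hi⟩ : Fin _) ≤ ⟨j, hj⟩ from hij)

/-! ### Lower bound -/

lemma lower_bound {V : Type*} [Fintype V] {T : SimpleGraph V} (hT : T.IsTree) {n : ℕ}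
    (hn : 2 ≤ n) (f : V × Fin n → ℕ) (hf : IsRadioLabelling (T □ (⊤ : SimpleGraph (Fin n))) f) :
    ((Fintype.card V * n : ℤ) - 1) * (T.diam + epsilon T) - 2 * n * totalLevel T ≤ spanOf f := by
  have := hT.connected.nonempty
  have : Inhabited (V × Fin n) := ⟨(Classical.arbitrary V, ⟨0, by omega⟩)⟩
  obtain ⟨x, hx, hmono⟩ := exists_sorted f
  have hcard : Fintype.card (V × Fin n) = Fintype.card V * n := by simp
  rw [hcard] at hx hmono
  obtain ⟨k, hk⟩ : ∃ k, Fintype.card V * n = k + 1 := by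
    refine ⟨Fintype.card V * n - 1, ?_⟩
    have : 0 < Fintype.card V * n := Nat.mul_pos Fintype.card_pos (by omega)
    omega
  have hk' : (Fintype.card V * n : ℤ) = k + 1 := by exact_mod_cast hk
  rw [hk] at hx hmono
  have hstep : ∀ i, i < k → ((T.diam + epsilon T : ℕ) : ℤ) - level T (x i).1 - level T (x (i + 1)).1
      ≤ (f (x (i + 1)) : ℤ) - f (x i) := by
    intro i hi
    have hne : x i ≠ x (i + 1) := by
      intro h
      have := hx.injOn (show i ∈ Set.Iio (k + 1) from by simp; omega)
        (show i + 1 ∈ Set.Iio (k + 1) from by simp; omega) h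
      omega
    have h1 := hf _ _ hne
    have h2 := hmono i (i + 1) (by omega) (by omega)
    rw [diam_prod hT hn, dist_prod hT hn, Nat.dist_eq_sub_of_le h2] at h1
    have h3 := dist_le_levels hT (x i).1 (x (i + 1)).1
    split_ifs at h1 <;> omega
  have hsum : ∀ j, j ≤ k → ∑ i ∈ Finset.range j, (((T.diam + epsilon T : ℕ) : ℤ)
      - level T (x i).1 - level T (x (i + 1)).1) ≤ (f (x j) : ℤ) - f (x 0) := by
    intro j
    induction j with
    | zero => simp
    | succ j ih =>
      intro hj
      rw [Finset.sum_range_succ]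
      have := ih (by omega)
      have := hstep j (by omega)
      omega
  have h := hsum k le_rfl
  rw [sum_telescope _ (fun i => (level T (x i).1 : ℤ)), sum_level_ordering T hx] at h
  have hs : Nat.dist (f (x k)) (f (x 0)) ≤ spanOf f :=
    Finset.le_sup (f := fun p : (V × Fin n) × (V × Fin n) => Nat.dist (f p.1) (f p.2))
      (Finset.mem_univ (x k, x 0))
  rw [Nat.dist_comm, Nat.dist_eq_sub_of_le (hmono 0 k (by omega) (by omega))] at hs
  have hs' : (f (x k) : ℤ) - f (x 0) ≤ spanOf f := by omega
  rw [hk']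
  push_cast at h
  have e : (2 : ℤ) * n * totalLevel T = 2 * (n * totalLevel T) := by ring
  rw [e]
  have e2 : ((k : ℤ) + 1 - 1) * (T.diam + epsilon T) = k * (T.diam + epsilon T) := by ring
  rw [e2]
  omega

/-! ### The core: an ordering with suitable properties gives the radio number -/

lemma core {V : Type*} [Fintype V] {T : SimpleGraph V} (hT : T.IsTree) {n N : ℕ}
    (hn : 2 ≤ n) (hN : Fintype.card V * n = N)
    (w : ℕ → V × Fin n) (hw : Set.BijOn w (Set.Iio N) Set.univ)
    (ha0 : level T (w 0).1 = 0) (ha1 : level T (w (N - 1)).1 = 0)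
    (hb : ∀ t, t + 1 < N → (w t).2 ≠ (w (t + 1)).2)
    (hdist : ∀ t, t + 1 < N → T.dist (w t).1 (w (t + 1)).1 + epsilon T =
      level T (w t).1 + level T (w (t + 1)).1 + 1)
    (h3 : epsilon T = 0 → ∀ t, t + 3 < N → T.dist (w t).1 (w (t + 3)).1 =
      level T (w t).1 + level T (w (t + 3)).1 + 1)
    (hmin : ∀ t, t + 2 < N →
      2 * min (T.dist (w t).1 (w (t + 1)).1) (T.dist (w (t + 1)).1 (w (t + 2)).1)
        ≤ T.diam + 1 - epsilon T)
    (he : ∀ t, t + 2 < N → (w t).2 = (w (t + 2)).2 →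
      2 * min (T.dist (w t).1 (w (t + 1)).1) (T.dist (w (t + 1)).1 (w (t + 2)).1) ≤ T.diam) :
    (radioNumber (T □ (⊤ : SimpleGraph (Fin n))) : ℤ) =
      ((Fintype.card V * n : ℤ) - 1) * (T.diam + epsilon T) - 2 * n * totalLevel T := by
  classical
  have := hT.connected.nonempty
  have hNpos : 0 < N := hN ▸ Nat.mul_pos Fintype.card_pos (by omega)
  have heps : epsilon T = 0 ∨ epsilon T = 1 := by unfold epsilon; split_ifs <;> simp
  set d := T.diam with hdd
  set D : ℕ → ℕ := fun i => T.dist (w i).1 (w (i + 1)).1 with hD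
  set l : ℕ → ℕ := fun i => level T (w i).1 with hl
  have hDle : ∀ i, D i ≤ d := fun i => dist_le_diam' hT.connected _ _
  set F : ℕ → ℕ := fun t => ∑ i ∈ Finset.range t, (d + 1 - D i) with hF
  have hFs : ∀ t, F (t + 1) = F t + (d + 1 - D t) := fun t => Finset.sum_range_succ _ _
  have hFm : Monotone F := monotone_nat_of_le_succ (fun t => by rw [hFs]; omega)
  have hdist' : ∀ t, t + 1 < N → D t + epsilon T = l t + l (t + 1) + 1 := hdist
  have hmin' : ∀ t, t + 2 < N → 2 * min (D t) (D (t + 1)) ≤ d + 1 - epsilon T := hmin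
  have he' : ∀ t, t + 2 < N → (w t).2 = (w (t + 2)).2 → 2 * min (D t) (D (t + 1)) ≤ d := he
  -- levels are small when there is one weight center
  have hlev : epsilon T = 1 → ∀ t, t < N → 2 * l t ≤ d := by
    intro h1 t ht
    rcases Nat.eq_zero_or_pos t with h0 | h0
    · subst h0
      have : l 0 = 0 := ha0
      omega
    · by_cases h2 : t = N - 1
      · have : l t = 0 := by rw [h2]; exact ha1
        omega
      · obtain ⟨s, rfl⟩ : ∃ s, t = s + 1 := ⟨t - 1, by omega⟩
        have a1 := hmin' s (by omega)
        have a2 := hdist' s (by omega)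
        have a3 := hdist' (s + 1) (by omega)
        omega
  have key : ∀ s t, s < t → t < N →
      d + 2 ≤ F t - F s + (T.dist (w s).1 (w t).1 + if (w s).2 = (w t).2 then 0 else 1) := by
    intro s t hst ht
    obtain ⟨r, rfl⟩ : ∃ r, t = s + 1 + r := ⟨t - s - 1, by omega⟩
    have d0 := hDle s
    have d1 := hDle (s + 1)
    have d2 := hDle (s + 2)
    have d3 := hDle (s + 3)
    have f0 := hFs s
    have f1 := hFs (s + 1)
    have f2 := hFs (s + 2)
    have f3 := hFs (s + 3)
    rw [show s + 1 + 1 = s + 2 by ring] at f1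
    rw [show s + 2 + 1 = s + 3 by ring] at f2
    rw [show s + 3 + 1 = s + 4 by ring] at f3
    match r, ht with
    | 0, ht =>
      have hbs := hb s (by omega)
      rw [show s + 1 + 0 = s + 1 by ring] at *
      rw [if_neg hbs, f0]
      change d + 2 ≤ _ + (D s + 1)
      omega
    | 1, ht =>
      rw [show s + 1 + 1 = s + 2 by ring] at *
      have t1 := hT.connected.dist_triangle (u := (w (s + 1)).1) (v := (w s).1) (w := (w (s + 2)).1)
      have t2 := hT.connected.dist_triangle (u := (w s).1) (v := (w (s + 2)).1) (w := (w (s + 1)).1)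
      rw [T.dist_comm (u := (w (s + 1)).1) (v := (w s).1)] at t1
      rw [T.dist_comm (u := (w (s + 2)).1) (v := (w (s + 1)).1)] at t2
      change D (s + 1) ≤ D s + _ at t1
      change D s ≤ _ + D (s + 1) at t2
      have m0 := hmin' s (by omega)
      have e0 := he' s (by omega)
      split_ifs with hv
      · have := e0 hv
        omega
      · omega
    | 2, ht =>
      rw [show s + 1 + 2 = s + 3 by ring] at *
      have q0 := hdist' s (by omega)
      have q1 := hdist' (s + 1) (by omega)
      have q2 := hdist' (s + 2) (by omega)
      rw [show s + 1 + 1 = s + 2 by ring] at q1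
      rw [show s + 2 + 1 = s + 3 by ring] at q2
      rcases heps with h0 | h1
      · have : T.dist (w s).1 (w (s + 3)).1 = l s + l (s + 3) + 1 := h3 h0 s ht
        omega
      · have m0 := hmin' s (by omega)
        have m1 := hmin' (s + 1) (by omega)
        rw [show s + 1 + 1 = s + 2 by ring] at m1
        have l0 := hlev h1 s (by omega)
        have l3 := hlev h1 (s + 3) (by omega)
        omega
    | r + 3, ht =>
      have m0 := hmin' s (by omega)
      have m2 := hmin' (s + 2) (by omega)
      rw [show s + 2 + 1 = s + 3 by ring] at m2
      have : F (s + 4) ≤ F (s + 1 + (r + 3)) := hFm (by omega)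
      omega
  have hsurj : ∀ p, ∃ t, t < N ∧ w t = p := by
    intro p
    obtain ⟨t, ht, h⟩ := hw.surjOn (Set.mem_univ p)
    exact ⟨t, ht, h⟩
  choose idx hidx hidx' using hsurj
  set f : V × Fin n → ℕ := fun p => F (idx p) with hf
  have hrad : IsRadioLabelling (T □ (⊤ : SimpleGraph (Fin n))) f := by
    intro u v huv
    rw [diam_prod hT hn, dist_prod hT hn]
    have hne : idx u ≠ idx v := by
      intro h
      apply huv
      rw [← hidx' u, ← hidx' v, h]
    rcases lt_or_gt_of_ne hne with h | h
    · have := key _ _ h (hidx v)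
      rw [hidx', hidx'] at this
      rw [Nat.dist_eq_sub_of_le (hFm h.le)]
      omega
    · have := key _ _ h (hidx u)
      rw [hidx', hidx', T.dist_comm] at this
      rw [Nat.dist_eq_sub_of_le_right (hFm h.le)]
      simp only [eq_comm (a := u.2)]
      omega
  have hspan : spanOf f ≤ F (N - 1) := by
    refine Finset.sup_le fun p _ => ?_
    have h1 : f p.1 ≤ F (N - 1) := hFm (by have := hidx p.1; omega)
    have h2 : f p.2 ≤ F (N - 1) := hFm (by have := hidx p.2; omega)
    rcases le_total (f p.1) (f p.2) with h | h
    · rw [Nat.dist_eq_sub_of_le h]; omega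
    · rw [Nat.dist_eq_sub_of_le_right h]; omega
  have hFN : (F (N - 1) : ℤ) =
      ((Fintype.card V * n : ℤ) - 1) * (d + epsilon T) - 2 * n * totalLevel T := by
    obtain ⟨k, hk⟩ : ∃ k, N = k + 1 := ⟨N - 1, by omega⟩
    have hk' : (Fintype.card V * n : ℤ) = k + 1 := by exact_mod_cast hN.trans hk
    have h1 := sum_telescope ((d + epsilon T : ℕ) : ℤ) (fun i => (l i : ℤ)) k
    rw [← hk, sum_level_ordering T hw] at h1
    rw [hk', show N - 1 = k by omega]
    have h2 : (F k : ℤ) = ∑ i ∈ Finset.range k, (((d + epsilon T : ℕ) : ℤ) - l i - l (i + 1)) := by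
      rw [hF, Nat.cast_sum]
      refine Finset.sum_congr rfl fun i hi => ?_
      have := hdist' i (by simp at hi; omega)
      have := hDle i
      omega
    rw [h2, h1]
    have l0 : l 0 = 0 := ha0
    have lk : l k = 0 := by
      have : k = N - 1 := by omega
      rw [this]; exact ha1
    rw [l0, lk]
    push_cast; ring
  have hmem : spanOf f ∈ { k | ∃ f : V × Fin n → ℕ,
      IsRadioLabelling (T □ (⊤ : SimpleGraph (Fin n))) f ∧ spanOf f = k } := ⟨f, hrad, rfl⟩
  apply le_antisymm
  · rw [← hFN]
    have : radioNumber (T □ (⊤ : SimpleGraph (Fin n))) ≤ spanOf f := Nat.sInf_le hmem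
    exact_mod_cast this.trans hspan
  · obtain ⟨g, hg, hg'⟩ := Nat.sInf_mem ⟨_, hmem⟩
    have := lower_bound hT hn g hg
    unfold radioNumber
    rw [← hg']
    exact this

/-! ### Two weight centers: rebuilding the ordering -/

/-- A counting (Hall type) condition extracted from the given ordering. -/
lemma hall {V : Type*} [Fintype V] {n N d M : ℕ} (hn : 0 < n)
    (w : ℕ → V × Fin n) (hw : Set.BijOn w (Set.Iio N) Set.univ)
    (P : V → Prop) (l : V → ℕ)
    (alt : ∀ t, t + 1 < N → (P (w t).1 ↔ ¬ P (w (t + 1)).1))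
    (hshort : ∀ t, t < N →
      (t + 1 < N ∧ 2 * (l (w t).1 + l (w (t + 1)).1 + 1) ≤ d + 1) ∨
      ∃ s, t = s + 1 ∧ 2 * (l (w t).1 + l (w s).1 + 1) ≤ d + 1)
    (hsingle : ∀ u, 2 * (l u + 1) ≤ d + 1)
    (e : ℕ) (heN : e < N) (he : e = 0 ∨ e + 1 = N) (hPe : ¬ P (w e).1) (hle : l (w e).1 = 0)
    (a b : ℕ → V) (ha : Set.BijOn a (Set.Iio M) {u | P u})
    (hb : Set.BijOn b (Set.Iio M) {u | ¬ P u})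
    (hma : ∀ i j, i ≤ j → j < M → l (a i) ≤ l (a j))
    (hmb : ∀ i j, i ≤ j → j < M → l (b i) ≤ l (b j)) :
    ∀ j, 1 ≤ j → 2 * j ≤ M → 2 * (l (a (M - 2 * j)) + l (b j) + 1) ≤ d + 1 := by
  classical
  intro j hj1 hjM
  by_contra hlong
  let A : Finset V := (Finset.Ico (M - 2 * j) M).image a
  let B : Finset V := (Finset.range j).image b
  have hA : A.card = 2 * j := by
    rw [Finset.card_image_of_injOn, Nat.card_Ico]
    · omega
    · intro x hx y hy h
      simp only [Finset.coe_Ico, Set.mem_Ico] at hx hy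
      exact ha.injOn hx.2 hy.2 h
  have hB : B.card ≤ j := Finset.card_image_le.trans (by simp)
  have hnB : ∀ v, ¬ P v → v ∉ B → l (b j) ≤ l v := by
    intro v hv hvB
    obtain ⟨i, hi, rfl⟩ := hb.surjOn hv
    refine hmb j i ?_ hi
    by_contra h
    exact hvB (Finset.mem_image_of_mem _ (by simp; omega))
  have hlA : ∀ u ∈ A, P u ∧ l (a (M - 2 * j)) ≤ l u := by
    intro u hu
    obtain ⟨i, hi, rfl⟩ := Finset.mem_image.1 hu
    simp only [Finset.mem_Ico] at hi
    exact ⟨ha.mapsTo hi.2, hma _ _ hi.1 hi.2⟩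
  have heB : (w e).1 ∈ B := by
    by_contra h
    have h1 := hnB _ hPe h
    have h2 := hsingle (a (M - 2 * j))
    omega
  let pos : Finset V → Finset ℕ := fun S => (Finset.range N).filter fun t => (w t).1 ∈ S
  have hpos : ∀ S : Finset V, (pos S).card = S.card * n := by
    intro S
    have : (pos S).card = (S ×ˢ (Finset.univ : Finset (Fin n))).card := by
      refine Finset.card_nbij w ?_ ?_ ?_
      · intro t ht
        have ht1 : t ∈ pos S := ht
        simp only [pos, Finset.mem_filter] at ht1
        simp [ht1.2]
      · intro x hx y hy h
        have hx1 : x ∈ pos S := hx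
        have hy1 : y ∈ pos S := hy
        simp only [pos, Finset.mem_filter, Finset.mem_range] at hx1 hy1
        exact hw.injOn hx1.1 hy1.1 h
      · intro p hp
        obtain ⟨t, ht, rfl⟩ := hw.surjOn (Set.mem_univ p)
        refine ⟨t, ?_, rfl⟩
        have ht' : t < N := ht
        simp only [Finset.coe_product, Set.mem_prod, Finset.mem_coe] at hp
        simp [pos, ht', hp.1]
    rw [this]; simp
  have hep : e ∈ pos B := by simp [pos, heB, heN]
  have hnb : ∀ t ∈ pos A, t < N ∧ ((t + 1 ∈ pos B) ∨ ∃ s, t = s + 1 ∧ s ∈ pos B) := by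
    intro t ht
    simp only [pos, Finset.mem_filter, Finset.mem_range] at ht
    refine ⟨ht.1, ?_⟩
    obtain ⟨hP, hl⟩ := hlA _ ht.2
    rcases hshort t ht.1 with ⟨h1, h2⟩ | ⟨s, rfl, h2⟩
    · left
      simp only [pos, Finset.mem_filter, Finset.mem_range]
      refine ⟨h1, ?_⟩
      by_contra h
      have := hnB _ ((alt t h1).1 hP) h
      omega
    · right
      refine ⟨s, rfl, ?_⟩
      simp only [pos, Finset.mem_filter, Finset.mem_range]
      refine ⟨by omega, ?_⟩
      by_contra h
      have hs : ¬ P (w s).1 := fun h' => (alt s ht.1).1 h' hP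
      have := hnB _ hs h
      omega
  have hBpos : 1 ≤ (pos B).card := Finset.card_pos.2 ⟨e, hep⟩
  have hcount : (pos A).card ≤ 2 * (pos B).card - 1 := by
    rcases he with he | he
    · have hsub : pos A ⊆ ((pos B).erase e).image Nat.pred ∪ (pos B).image Nat.succ := by
        intro t ht
        rw [Finset.mem_union, Finset.mem_image, Finset.mem_image]
        rcases (hnb t ht).2 with h | ⟨s, rfl, h⟩
        · exact Or.inl ⟨t + 1, Finset.mem_erase.2 ⟨by omega, h⟩, rfl⟩
        · exact Or.inr ⟨s, h, rfl⟩
      have h1 := Finset.card_le_card hsub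
      have h2 := Finset.card_union_le (((pos B).erase e).image Nat.pred) ((pos B).image Nat.succ)
      have h3 : (((pos B).erase e).image Nat.pred).card ≤ _ := Finset.card_image_le
      have h4 : ((pos B).image Nat.succ).card ≤ _ := Finset.card_image_le
      rw [Finset.card_erase_of_mem hep] at h3
      omega
    · have hsub : pos A ⊆ (pos B).image Nat.pred ∪ ((pos B).erase e).image Nat.succ := by
        intro t ht
        rw [Finset.mem_union, Finset.mem_image, Finset.mem_image]
        have h0 := (hnb t ht).1
        rcases (hnb t ht).2 with h | ⟨s, rfl, h⟩
        · exact Or.inl ⟨t + 1, h, rfl⟩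
        · exact Or.inr ⟨s, Finset.mem_erase.2 ⟨by omega, h⟩, rfl⟩
      have h1 := Finset.card_le_card hsub
      have h2 := Finset.card_union_le ((pos B).image Nat.pred) (((pos B).erase e).image Nat.succ)
      have h3 : (((pos B).erase e).image Nat.succ).card ≤ _ := Finset.card_image_le
      have h4 : ((pos B).image Nat.pred).card ≤ _ := Finset.card_image_le
      rw [Finset.card_erase_of_mem hep] at h3
      omega
  rw [hpos, hA] at hcount
  have h5 : (pos B).card ≤ j * n := by rw [hpos]; exact Nat.mul_le_mul_right _ hB
  have h6 : 2 * j * n = 2 * (j * n) := by ring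
  have h7 : 0 < j * n := Nat.mul_pos hj1 hn
  omega

/-- Order in which the left vertices (sorted by level) are visited. -/
def leftIdx (M j : ℕ) : ℕ :=
  if j + 1 = M then M - 1 else if j % 3 = 0 then j / 3 else M - 2 * (j / 3) - 1 - j % 3

/-- Order in which the right vertices (sorted by level) are visited. -/
def rightIdx (M j : ℕ) : ℕ :=
  if j + 1 = M then 0 else if j % 3 = 0 then M - 2 * (j / 3) - 1
  else if j % 3 = 1 then j / 3 + 1 else M - 2 * (j / 3) - 2

lemma leftIdx_lt {M j : ℕ} (h : j < M) : leftIdx M j < M := by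
  unfold leftIdx; split_ifs <;> omega

lemma rightIdx_lt {M j : ℕ} (h : j < M) : rightIdx M j < M := by
  unfold rightIdx; split_ifs <;> omega

lemma leftIdx_inj {M i j : ℕ} (hi : i < M) (hj : j < M) (h : leftIdx M i = leftIdx M j) :
    i = j := by
  unfold leftIdx at h; split_ifs at h <;> omega

lemma rightIdx_inj {M i j : ℕ} (hi : i < M) (hj : j < M) (h : rightIdx M i = rightIdx M j) :
    i = j := by
  unfold rightIdx at h; split_ifs at h <;> omega

section seq
variable {d M : ℕ} {A B : ℕ → ℕ}

lemma left_short (hA0 : A 0 = 0) (hB0 : B 0 = 0) (hsA : ∀ i, 2 * (A i + 1) ≤ d + 1)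
    (hsB : ∀ i, 2 * (B i + 1) ≤ d + 1)
    (hma : ∀ i j, i ≤ j → j < M → A i ≤ A j)
    (hmb : ∀ i j, i ≤ j → j < M → B i ≤ B j)
    (h1 : ∀ j, 1 ≤ j → 2 * j ≤ M → 2 * (A (M - 2 * j) + B j + 1) ≤ d + 1)
    (h2 : ∀ j, 1 ≤ j → 2 * j ≤ M → 2 * (B (M - 2 * j) + A j + 1) ≤ d + 1)
    (j : ℕ) (hj : j < M) :
    2 * (A (leftIdx M j) + B (rightIdx M j) + 1) ≤ d + 1 ∨
    ∃ i, j = i + 1 ∧ 2 * (A (leftIdx M j) + B (rightIdx M i) + 1) ≤ d + 1 := by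
  by_cases hlast : j + 1 = M
  · left
    simp only [leftIdx, rightIdx, hlast, if_true, hB0]
    have := hsA (M - 1); omega
  obtain ⟨q, hq⟩ : ∃ q, j / 3 = q := ⟨_, rfl⟩
  have h3 : j % 3 = 0 ∨ j % 3 = 1 ∨ j % 3 = 2 := by omega
  rcases h3 with h | h | h
  · left
    have e1 : leftIdx M j = q := by simp [leftIdx, hlast, h, hq]
    have e2 : rightIdx M j = M - 2 * q - 1 := by simp [rightIdx, hlast, h, hq]
    rw [e1, e2]
    rcases Nat.eq_zero_or_pos q with h0 | h0
    · subst h0; rw [hA0]; have := hsB (M - 2 * 0 - 1); omega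
    · have := h2 q h0 (by omega)
      have := hmb (M - 2 * q - 1) (M - 2 * q) (by omega) (by omega)
      omega
  · left
    have e1 : leftIdx M j = M - 2 * (q + 1) := by simp [leftIdx, hlast, h, hq]; omega
    have e2 : rightIdx M j = q + 1 := by simp [rightIdx, hlast, h, hq]
    rw [e1, e2]
    exact h1 (q + 1) (by omega) (by omega)
  · right
    refine ⟨j - 1, by omega, ?_⟩
    have e1 : leftIdx M j = M - 2 * (q + 1) - 1 := by simp [leftIdx, hlast, h, hq]; omega
    have e2 : rightIdx M (j - 1) = q + 1 := by
      unfold rightIdx; split_ifs <;> omega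
    rw [e1, e2]
    have := h1 (q + 1) (by omega) (by omega)
    have := hma (M - 2 * (q + 1) - 1) (M - 2 * (q + 1)) (by omega) (by omega)
    omega

lemma right_short (hA0 : A 0 = 0) (hB0 : B 0 = 0) (hsA : ∀ i, 2 * (A i + 1) ≤ d + 1)
    (hsB : ∀ i, 2 * (B i + 1) ≤ d + 1)
    (hmb : ∀ i j, i ≤ j → j < M → B i ≤ B j)
    (h1 : ∀ j, 1 ≤ j → 2 * j ≤ M → 2 * (A (M - 2 * j) + B j + 1) ≤ d + 1)
    (h2 : ∀ j, 1 ≤ j → 2 * j ≤ M → 2 * (B (M - 2 * j) + A j + 1) ≤ d + 1)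
    (j : ℕ) (hj : j < M) :
    2 * (A (leftIdx M j) + B (rightIdx M j) + 1) ≤ d + 1 ∨
    (j + 1 < M ∧ 2 * (A (leftIdx M (j + 1)) + B (rightIdx M j) + 1) ≤ d + 1) := by
  by_cases hlast : j + 1 = M
  · left
    simp only [leftIdx, rightIdx, hlast, if_true, hB0]
    have := hsA (M - 1); omega
  obtain ⟨q, hq⟩ : ∃ q, j / 3 = q := ⟨_, rfl⟩
  have h3 : j % 3 = 0 ∨ j % 3 = 1 ∨ j % 3 = 2 := by omega
  rcases h3 with h | h | h
  · left
    have e1 : leftIdx M j = q := by simp [leftIdx, hlast, h, hq]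
    have e2 : rightIdx M j = M - 2 * q - 1 := by simp [rightIdx, hlast, h, hq]
    rw [e1, e2]
    rcases Nat.eq_zero_or_pos q with h0 | h0
    · subst h0; rw [hA0]; have := hsB (M - 2 * 0 - 1); omega
    · have := h2 q h0 (by omega)
      have := hmb (M - 2 * q - 1) (M - 2 * q) (by omega) (by omega)
      omega
  · left
    have e1 : leftIdx M j = M - 2 * (q + 1) := by simp [leftIdx, hlast, h, hq]; omega
    have e2 : rightIdx M j = q + 1 := by simp [rightIdx, hlast, h, hq]
    rw [e1, e2]
    exact h1 (q + 1) (by omega) (by omega)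
  · have e2 : rightIdx M j = M - 2 * (q + 1) := by simp [rightIdx, hlast, h, hq]; omega
    have key := h2 (q + 1) (by omega) (by omega)
    by_cases hl2 : j + 2 = M
    · left
      have e1 : leftIdx M j = q + 1 := by simp [leftIdx, hlast, h, hq]; omega
      rw [e1, e2]; omega
    · right
      refine ⟨by omega, ?_⟩
      have e1 : leftIdx M (j + 1) = q + 1 := by
        unfold leftIdx; split_ifs <;> omega
      rw [e1, e2]; omega

end seq

lemma exists_seq {V : Type*} {d M : ℕ} (hM : 0 < M) (P : V → Prop) (l : V → ℕ)
    (a b : ℕ → V) (ha : Set.BijOn a (Set.Iio M) {u | P u})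
    (hb : Set.BijOn b (Set.Iio M) {u | ¬ P u})
    (hA0 : l (a 0) = 0) (hB0 : l (b 0) = 0)
    (hsingle : ∀ u, 2 * (l u + 1) ≤ d + 1)
    (hma : ∀ i j, i ≤ j → j < M → l (a i) ≤ l (a j))
    (hmb : ∀ i j, i ≤ j → j < M → l (b i) ≤ l (b j))
    (h1 : ∀ j, 1 ≤ j → 2 * j ≤ M → 2 * (l (a (M - 2 * j)) + l (b j) + 1) ≤ d + 1)
    (h2 : ∀ j, 1 ≤ j → 2 * j ≤ M → 2 * (l (b (M - 2 * j)) + l (a j) + 1) ≤ d + 1) :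
    ∃ x : ℕ → V, Set.InjOn x (Set.Iio (2 * M)) ∧ (∀ t, t < 2 * M → (P (x t) ↔ t % 2 = 0)) ∧
      l (x 0) = 0 ∧ l (x (2 * M - 1)) = 0 ∧
      ∀ t, t < 2 * M → (t + 1 < 2 * M ∧ 2 * (l (x t) + l (x (t + 1)) + 1) ≤ d + 1) ∨
        ∃ s, t = s + 1 ∧ 2 * (l (x t) + l (x s) + 1) ≤ d + 1 := by
  set x : ℕ → V := fun t => if t % 2 = 0 then a (leftIdx M (t / 2)) else b (rightIdx M (t / 2))
    with hx
  have hxe : ∀ j, x (2 * j) = a (leftIdx M j) := by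
    intro j
    simp [hx]
  have hxo : ∀ j, x (2 * j + 1) = b (rightIdx M j) := by
    intro j
    have e1 : (2 * j + 1) % 2 = 1 := by omega
    have e2 : (2 * j + 1) / 2 = j := by omega
    simp [hx, e1, e2]
  have hP : ∀ t, t < 2 * M → (P (x t) ↔ t % 2 = 0) := by
    intro t ht
    rcases Nat.even_or_odd' t with ⟨j, rfl | rfl⟩
    · rw [hxe]
      have : P (a (leftIdx M j)) := ha.mapsTo (leftIdx_lt (by omega))
      simp [this]
    · rw [hxo]
      have : ¬ P (b (rightIdx M j)) := hb.mapsTo (rightIdx_lt (by omega))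
      simp only [this, false_iff]; omega
  refine ⟨x, ?_, hP, ?_, ?_, ?_⟩
  · intro s hs t ht h
    have hs' : s < 2 * M := hs
    have ht' : t < 2 * M := ht
    have p1 := hP s hs'
    have p2 := hP t ht'
    rw [h, p2] at p1
    rcases Nat.even_or_odd' s with ⟨i, rfl | rfl⟩ <;> rcases Nat.even_or_odd' t with ⟨j, rfl | rfl⟩
    · rw [hxe, hxe] at h
      rw [leftIdx_inj (by omega) (by omega)
        (ha.injOn (leftIdx_lt (show i < M by omega)) (leftIdx_lt (show j < M by omega)) h)]
    · omega
    · omega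
    · rw [hxo, hxo] at h
      rw [rightIdx_inj (by omega) (by omega)
        (hb.injOn (rightIdx_lt (show i < M by omega)) (rightIdx_lt (show j < M by omega)) h)]
  · have : leftIdx M 0 = 0 := by unfold leftIdx; split_ifs <;> omega
    rw [show 0 = 2 * 0 by rfl, hxe, this, hA0]
  · have : rightIdx M (M - 1) = 0 := by unfold rightIdx; split_ifs <;> omega
    rw [show 2 * M - 1 = 2 * (M - 1) + 1 by omega, hxo, this, hB0]
  · intro t ht
    rcases Nat.even_or_odd' t with ⟨j, rfl | rfl⟩
    · rcases left_short (A := fun i => l (a i)) (B := fun i => l (b i)) hA0 hB0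
        (fun i => hsingle _) (fun i => hsingle _) hma hmb h1 h2 j (by omega) with h | ⟨i, rfl, h⟩
      · left
        rw [hxe, hxo]
        exact ⟨by omega, h⟩
      · right
        refine ⟨2 * i + 1, by ring, ?_⟩
        rw [hxe, hxo]
        exact h
    · rcases right_short (A := fun i => l (a i)) (B := fun i => l (b i)) hA0 hB0
        (fun i => hsingle _) (fun i => hsingle _) hmb h1 h2 j (by omega) with h | ⟨h', h⟩
      · right
        refine ⟨2 * j, rfl, ?_⟩
        rw [hxe, hxo]
        omega
      · left
        rw [show 2 * j + 1 + 1 = 2 * (j + 1) by ring, hxe, hxo]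
        exact ⟨by omega, by omega⟩

lemma add_mod_ne {n q g g' : ℕ} (hg : g < n) (hg' : g' < n) (h : g ≠ g') :
    (q + g) % n ≠ (q + g') % n := by
  intro h'
  have : g ≡ g' [MOD n] := Nat.ModEq.add_left_cancel' q h'
  exact h (by rwa [Nat.ModEq, Nat.mod_eq_of_lt hg, Nat.mod_eq_of_lt hg'] at this)

/-- Shift of the colour at position `s` of a block of length `m`. -/
def shift (m s : ℕ) : ℕ := if m % 3 = 2 then (2 * s) % 3 else s % 3

lemma shift_lt (m s : ℕ) : shift m s < 3 := by unfold shift; split_ifs <;> omega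

lemma exists_order {V : Type*} [Fintype V] {n m : ℕ} (hn : 3 ≤ n) (hm : Fintype.card V = m)
    (hm0 : 2 ≤ m) (x : ℕ → V) (hx : Set.InjOn x (Set.Iio m)) :
    ∃ w : ℕ → V × Fin n, Set.BijOn w (Set.Iio (m * n)) Set.univ ∧
      (∀ t, (w t).1 = x (t % m)) ∧ (∀ t, (w t).2 ≠ (w (t + 1)).2) ∧
      (∀ t, t % m + 2 < m → (w t).2 ≠ (w (t + 2)).2) := by
  set w : ℕ → V × Fin n := fun t =>
    (x (t % m), ⟨(t / m + shift m (t % m)) % n, Nat.mod_lt _ (by omega)⟩) with hw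
  have hdm : ∀ q s, s < m → (m * q + s) / m = q ∧ (m * q + s) % m = s := by
    intro q s hs
    constructor
    · rw [Nat.mul_add_div (by omega), Nat.div_eq_of_lt hs, add_zero]
    · rw [Nat.mul_add_mod, Nat.mod_eq_of_lt hs]
  have hrep : ∀ t, ∃ q s, s < m ∧ t = m * q + s := fun t =>
    ⟨t / m, t % m, Nat.mod_lt _ (by omega), (Nat.div_add_mod t m).symm⟩
  have hw2 : ∀ q s, s < m → ((w (m * q + s)).2 : ℕ) = (q + shift m s) % n := by
    intro q s hs
    simp only [hw, (hdm q s hs).1, (hdm q s hs).2]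
  have hinj : Set.InjOn w (Set.Iio (m * n)) := by
    intro t ht t' ht' h
    have ht : t < m * n := ht
    have ht' : t' < m * n := ht'
    have hq : t / m < n := Nat.div_lt_of_lt_mul ht
    have hq' : t' / m < n := Nat.div_lt_of_lt_mul ht'
    have e1 : x (t % m) = x (t' % m) := congrArg Prod.fst h
    have e2 : t % m = t' % m :=
      hx (Nat.mod_lt _ (by omega)) (Nat.mod_lt _ (by omega)) e1
    have e3 : (t / m + shift m (t % m)) % n = (t' / m + shift m (t' % m)) % n :=
      congrArg (fun p => (p.2 : ℕ)) h
    rw [← e2, add_comm, add_comm (t' / m)] at e3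
    have e4 : t / m = t' / m := by
      by_contra hne
      exact add_mod_ne hq hq' hne e3
    rw [← Nat.div_add_mod t m, ← Nat.div_add_mod t' m, e2, e4]
  refine ⟨w, ⟨fun _ _ => Set.mem_univ _, hinj, ?_⟩, fun t => rfl, ?_, ?_⟩
  · have hcard : Fintype.card (V × Fin n) = (Finset.range (m * n)).card := by
      simp [hm]
    have := Finset.surj_on_of_inj_on_of_card_le (s := Finset.range (m * n))
      (t := (Finset.univ : Finset (V × Fin n))) (fun t _ => w t) (by simp)
      (fun a b ha hb h => hinj (by simpa using ha) (by simpa using hb) h)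
      (by rw [Finset.card_univ, hcard])
    intro p _
    obtain ⟨t, ht, h⟩ := this p (Finset.mem_univ _)
    exact ⟨t, by simpa using ht, h.symm⟩
  · intro t h
    obtain ⟨q, s, hs, rfl⟩ := hrep t
    have h := congrArg Fin.val h
    have l1 := shift_lt m s
    by_cases hs1 : s + 1 < m
    · rw [hw2 q s hs, show m * q + s + 1 = m * q + (s + 1) by ring, hw2 q (s + 1) hs1] at h
      have l2 := shift_lt m (s + 1)
      refine add_mod_ne (by omega) (by omega) ?_ h
      unfold shift; split_ifs <;> omega
    · have hs2 : s + 1 = m := by omega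
      rw [hw2 q s hs, show m * q + s + 1 = m * (q + 1) + 0 by rw [add_assoc, hs2]; ring,
        hw2 (q + 1) 0 (by omega)] at h
      have h0 : shift m 0 = 0 := by unfold shift; split_ifs <;> omega
      rw [h0, add_zero] at h
      refine add_mod_ne (by omega) (by omega) ?_ h
      unfold shift; split_ifs <;> omega
  · intro t hts h
    obtain ⟨q, s, hs, rfl⟩ := hrep t
    rw [(hdm q s hs).2] at hts
    have h := congrArg Fin.val h
    rw [hw2 q s hs, show m * q + s + 2 = m * q + (s + 2) by ring, hw2 q (s + 2) hts] at h
    have l1 := shift_lt m s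
    have l2 := shift_lt m (s + 2)
    refine add_mod_ne (by omega) (by omega) ?_ h
    unfold shift; split_ifs <;> omega

/-- Sorted enumeration of the vertices satisfying `Q`. -/
lemma exists_sorted_on {V : Type*} [Fintype V] (l : V → ℕ) (Q : V → Prop) [DecidablePred Q] (c : V)
    (hc : Q c) (hlc : l c = 0) {M : ℕ} (hM : (Finset.univ.filter Q).card = M) :
    ∃ a : ℕ → V, Set.BijOn a (Set.Iio M) {u | Q u} ∧
      (∀ i j, i ≤ j → j < M → l (a i) ≤ l (a j)) ∧ l (a 0) = 0 := by
  have : Inhabited {u // Q u} := ⟨⟨c, hc⟩⟩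
  obtain ⟨x, hx, hmono⟩ := exists_sorted (fun u : {u // Q u} => l u.1)
  rw [Fintype.card_subtype, hM] at hx hmono
  refine ⟨fun i => (x i).1, ⟨fun i _ => (x i).2, ?_, ?_⟩, hmono, ?_⟩
  · intro i hi j hj h
    exact hx.injOn hi hj (Subtype.ext h)
  · intro u hu
    obtain ⟨i, hi, h⟩ := hx.surjOn (Set.mem_univ (⟨u, hu⟩ : {u // Q u}))
    exact ⟨i, hi, by simp [h]⟩
  · obtain ⟨i, hi, h⟩ := hx.surjOn (Set.mem_univ (⟨c, hc⟩ : {u // Q u}))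
    have := hmono 0 i (by omega) hi
    rw [h] at this
    change l (x 0).1 ≤ l c at this
    change l (x 0).1 = 0
    omega

lemma iff_flip {A A' B C C' : Prop} (h1 : A ↔ (B ↔ C)) (h2 : A ↔ ¬ A') (h3 : C' ↔ ¬ C) :
    A' ↔ (B ↔ C') := by tauto

lemma iff_clash {A B S R : Prop} (h1 : A ↔ S) (h2 : A ↔ R) (h3 : B ↔ S) (h4 : ¬ (B ↔ R)) :
    False := by tauto

set_option maxHeartbeats 2000000 in
/-- The case of two weight centers. -/
lemma two_centers {V : Type*} [Fintype V]
    {T : SimpleGraph V} (hT : T.IsTree) {m n : ℕ}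
    (hm : Fintype.card V = m) (hd : 2 ≤ T.diam) (hn : 2 ≤ n)
    {p q : V} (hpq : T.Adj p q) (hW : weightCenters T = {p, q})
    (w : ℕ → V × Fin n) (hw : Set.BijOn w (Set.Iio (m * n)) Set.univ)
    (ha0 : level T (w 0).1 = 0) (ha1 : level T (w (m * n - 1)).1 = 0)
    (hb : ∀ t, t + 1 < m * n → (w t).2 ≠ (w (t + 1)).2)
    (hc : ∀ t, t + 1 < m * n → InOppositeBranches T (w t).1 (w (t + 1)).1)
    (hmin : ∀ t, t + 2 < m * n →
      2 * min (T.dist (w t).1 (w (t + 1)).1) (T.dist (w (t + 1)).1 (w (t + 2)).1)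
        ≤ T.diam + 1) :
    (radioNumber (T □ (⊤ : SimpleGraph (Fin n))) : ℤ) =
      ((Fintype.card V * n : ℤ) - 1) * (T.diam + epsilon T) - 2 * n * totalLevel T := by
  classical
  have hne := hT.connected.nonempty
  have heps := epsilon_two hpq hW
  have hlv := level_two hW
  set P : V → Prop := fun u => T.dist u q = T.dist u p + 1 with hP
  have hstep := fun u => hT.dist_eq_dist_add_one_of_adj u hpq
  have hlP : ∀ u, P u → level T u = T.dist u p := by
    intro u hu
    have hu : T.dist u q = T.dist u p + 1 := hu
    rw [hlv]; omega
  have hnP : ∀ u, ¬ P u → T.dist u p = T.dist u q + 1 := by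
    intro u hu
    exact (hstep u).resolve_right hu
  have hlnP : ∀ u, ¬ P u → level T u = T.dist u q := by
    intro u hu
    have := hnP u hu
    rw [hlv]; omega
  have hPp : P p := by
    change T.dist p q = T.dist p p + 1
    rw [dist_eq_one_iff_adj.2 hpq]; simp
  have hPq : ¬ P q := by
    change ¬ (T.dist q q = T.dist q p + 1)
    simp
  have hlp : level T p = 0 := by rw [hlP p hPp]; simp
  have hlq : level T q = 0 := by rw [hlnP q hPq]; simp
  -- vertices on different sides
  have across : ∀ u v, P u → ¬ P v → T.dist u v = level T u + level T v + 1 := by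
    intro u v hu hv
    rw [hlP u hu, hlnP v hv]
    have := dist_across hT u v _ p q hpq hu (hnP v hv) rfl
    omega
  have across' : ∀ u v, (P u ↔ ¬ P v) → T.dist u v = level T u + level T v + 1 := by
    intro u v huv
    by_cases hu : P u
    · exact across u v hu (huv.1 hu)
    · have hv : P v := not_not.1 fun h => hu (huv.2 h)
      rw [T.dist_comm, across v u hv hu]; ring
  have hopp : ∀ u v, InOppositeBranches T u v → (P u ↔ ¬ P v) := by
    intro u v huv
    have e1 := huv.2 p (by rw [hW]; simp)
    have e2 := huv.2 q (by rw [hW]; simp)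
    unfold onPath at e1 e2
    rw [T.dist_comm (u := p)] at e1
    rw [T.dist_comm (u := q)] at e2
    have h1 := hstep u
    have h2 := hstep v
    change T.dist u q = T.dist u p + 1 ↔ ¬ (T.dist v q = T.dist v p + 1)
    omega
  have alt : ∀ t, t + 1 < m * n → (P (w t).1 ↔ ¬ P (w (t + 1)).1) :=
    fun t ht => hopp _ _ (hc t ht)
  have hD : ∀ t, t + 1 < m * n → T.dist (w t).1 (w (t + 1)).1 =
      level T (w t).1 + level T (w (t + 1)).1 + 1 := fun t ht => across' _ _ (alt t ht)
  -- both sides have the same size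
  obtain ⟨M, hM⟩ : ∃ M, (Finset.univ.filter P).card = M := ⟨_, rfl⟩
  have hwt : weight T p = weight T q := by
    have h1 : p ∈ weightCenters T := by rw [hW]; simp
    have h2 : q ∈ weightCenters T := by rw [hW]; simp
    exact le_antisymm (h1 q) (h2 p)
  have hM' : (Finset.univ.filter fun u => ¬ P u).card = M := by
    have h0 : ∑ u, ((T.dist u q : ℤ) - T.dist u p) = 0 := by
      rw [Finset.sum_sub_distrib]
      unfold weight at hwt
      have : (∑ u, (T.dist u p : ℤ)) = ∑ u, (T.dist u q : ℤ) := by exact_mod_cast hwt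
      omega
    have h1 : ∑ u, ((T.dist u q : ℤ) - T.dist u p) = ∑ u, (if P u then (1 : ℤ) else -1) := by
      refine Finset.sum_congr rfl fun u _ => ?_
      split_ifs with h
      · have h : T.dist u q = T.dist u p + 1 := h
        omega
      · have := hnP u h
        omega
    rw [h1, Finset.sum_ite] at h0
    simp only [Finset.sum_const, nsmul_eq_mul, mul_one, mul_neg, hM] at h0
    omega
  have hcard : m = 2 * M := by
    have := Finset.card_filter_add_card_filter_not (s := (Finset.univ : Finset V)) P
    rw [hM, hM', Finset.card_univ, hm] at this
    omega
  have hMpos : 0 < M := by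
    rw [← hM]; exact Finset.card_pos.2 ⟨p, by simp [hPp]⟩
  have hm2 : 2 ≤ m := by omega
  have hNe : m * n = 2 * (M * n) := by rw [hcard]; ring
  have hMn : 0 < M * n := Nat.mul_pos hMpos (by omega)
  -- parity of positions
  have hpar : ∀ t, t < m * n → (P (w t).1 ↔ (P (w 0).1 ↔ t % 2 = 0)) := by
    intro t
    induction t with
    | zero => simp
    | succ t ih =>
      intro ht
      have h1 := ih (by omega)
      have h2 := alt t ht
      have h3 : (t + 1) % 2 = 0 ↔ ¬ (t % 2 = 0) := by omega
      exact iff_flip h1 h2 h3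
  -- n = 2 is impossible
  have hn3 : 3 ≤ n := by
    by_contra hlt
    have hn2 : n = 2 := by omega
    subst hn2
    have hcol : ∀ t, t < m * 2 → ((w t).2.val = 0 ↔ ((w 0).2.val = 0 ↔ t % 2 = 0)) := by
      intro t
      induction t with
      | zero => simp
      | succ t ih =>
        intro ht
        have h1 := ih (by omega)
        have h2 := hb t ht
        have h3 : (t + 1) % 2 = 0 ↔ ¬ (t % 2 = 0) := by omega
        have h4 : (w t).2.val = 0 ↔ ¬ ((w (t + 1)).2.val = 0) := by
          have := Fin.val_ne_of_ne h2
          have := (w t).2.isLt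
          have := (w (t + 1)).2.isLt
          omega
        exact iff_flip h1 h4 h3
    obtain ⟨s, hs, hs'⟩ := hw.surjOn (Set.mem_univ (p, (0 : Fin 2)))
    obtain ⟨t, ht, ht'⟩ := hw.surjOn (Set.mem_univ (p, (1 : Fin 2)))
    have a1 := hpar s hs
    have a2 := hpar t ht
    have a3 := hcol s hs
    have a4 := hcol t ht
    rw [hs'] at a1 a3
    rw [ht'] at a2 a4
    simp only [hPp, true_iff, Fin.val_zero, Fin.val_one, one_ne_zero, false_iff] at a1 a2 a3 a4
    exact iff_clash a1 a2 a3 a4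
  -- short edges
  have hshort : ∀ t, t < m * n →
      (t + 1 < m * n ∧ 2 * (level T (w t).1 + level T (w (t + 1)).1 + 1) ≤ T.diam + 1) ∨
      ∃ s, t = s + 1 ∧ 2 * (level T (w t).1 + level T (w s).1 + 1) ≤ T.diam + 1 := by
    intro t ht
    rcases Nat.eq_zero_or_pos t with h0 | h0
    · subst h0
      left
      refine ⟨by omega, ?_⟩
      by_cases h2 : 2 < m * n
      · have a1 := hmin 0 h2
        have a2 := hD 0 (by omega)
        have a3 := hD 1 (by omega)
        simp only [zero_add] at a1 a2 a3 ⊢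
        rw [show 1 + 1 = 2 by rfl] at a3
        omega
      · exfalso
        have : 1 * 3 ≤ M * n := Nat.mul_le_mul hMpos hn3
        omega
    · obtain ⟨s, rfl⟩ : ∃ s, t = s + 1 := ⟨t - 1, by omega⟩
      have a2 := hD s (by omega)
      by_cases h2 : s + 2 < m * n
      · have a1 := hmin s h2
        have a3 := hD (s + 1) (by omega)
        rw [show s + 1 + 1 = s + 2 by ring] at a3 ⊢
        by_cases h3 : 2 * T.dist (w s).1 (w (s + 1)).1 ≤ T.diam + 1
        · right; exact ⟨s, rfl, by omega⟩
        · left; exact ⟨h2, by omega⟩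
      · right
        refine ⟨s, rfl, ?_⟩
        have e : m * n - 1 = s + 1 := by omega
        rw [e] at ha1
        have hs : 0 < s := by
          have : 1 * 3 ≤ M * n := Nat.mul_le_mul hMpos hn3
          omega
        obtain ⟨r, rfl⟩ : ∃ r, s = r + 1 := ⟨s - 1, by omega⟩
        have a1 := hmin r (by omega)
        have a3 := hD r (by omega)
        rw [show r + 1 + 1 = r + 2 by ring] at *
        omega
  have hsingle : ∀ u, 2 * (level T u + 1) ≤ T.diam + 1 := by
    intro u
    obtain ⟨t, ht, h⟩ := hw.surjOn (Set.mem_univ (u, (⟨0, by omega⟩ : Fin n)))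
    have hu : (w t).1 = u := by rw [h]
    rcases hshort t ht with ⟨-, h2⟩ | ⟨s, -, h2⟩ <;> rw [hu] at h2 <;> omega
  obtain ⟨a, ha, hma, hla⟩ := exists_sorted_on (level T) P p hPp hlp hM
  obtain ⟨b, hbb, hmb, hlb⟩ := exists_sorted_on (level T) (fun u => ¬ P u) q hPq hlq hM'
  -- the two ends lie on different sides
  have hends : ∃ e e', e < m * n ∧ e' < m * n ∧ (e = 0 ∨ e + 1 = m * n) ∧
      (e' = 0 ∨ e' + 1 = m * n) ∧ ¬ P (w e).1 ∧ P (w e').1 ∧ level T (w e).1 = 0 ∧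
      level T (w e').1 = 0 := by
    have h1 := hpar (m * n - 1) (by omega)
    have h2 : ¬ ((m * n - 1) % 2 = 0) := by omega
    by_cases h0 : P (w 0).1
    · exact ⟨m * n - 1, 0, by omega, by omega, by omega, by omega, fun h => h2 ((h1.1 h).1 h0), h0, ha1, ha0⟩
    · exact ⟨0, m * n - 1, by omega, by omega, by omega, by omega, h0, h1.2 ⟨fun h => absurd h h0, fun h => absurd h h2⟩, ha0, ha1⟩
  obtain ⟨e, e', he, he', hee, hee', hPe, hPe', hle, hle'⟩ := hends
  have hall1 := hall (by omega) w hw P (level T) alt hshort hsingle e he hee hPe hle a b ha hbb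
    hma hmb
  have hall2 := hall (by omega) w hw (fun u => ¬ P u) (level T)
    (fun t ht => not_congr (alt t ht)) hshort hsingle e' he' hee' (not_not.2 hPe') hle' b a hbb
    (by simpa only [not_not] using ha) hmb hma
  obtain ⟨x, hxinj, hxP, hx0, hx1, hxs⟩ := exists_seq hMpos P (level T) a b ha hbb hla hlb hsingle
    hma hmb hall1 hall2
  rw [← hcard] at hxinj hxP hx1 hxs
  obtain ⟨w', hw', hwx, hcol1, hcol2⟩ := exists_order hn3 hm hm2 x hxinj
  have hmlt : ∀ t, t % m < m := fun t => Nat.mod_lt _ (by omega)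
  have hmpar : ∀ t, (t % m) % 2 = t % 2 := fun t => Nat.mod_mod_of_dvd t ⟨M, hcard⟩
  have hw'P : ∀ t, P (w' t).1 ↔ t % 2 = 0 := by
    intro t
    rw [hwx, hxP _ (hmlt t), hmpar]
  have hD' : ∀ s t, s % 2 ≠ t % 2 → T.dist (w' s).1 (w' t).1 =
      level T (w' s).1 + level T (w' t).1 + 1 := by
    intro s t hst
    apply across'
    rw [hw'P, hw'P]
    omega
  have hsucc : ∀ t k, t % m + k < m → (t + k) % m = t % m + k := by
    intro t k h
    rw [Nat.add_mod, Nat.mod_eq_of_lt (a := k) (by omega), Nat.mod_eq_of_lt h]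
  have hwrap : ∀ t, t % m + 1 = m → T.dist (w' t).1 (w' (t + 1)).1 = 1 := by
    intro t h
    rw [hD' t (t + 1) (by omega), hwx, hwx]
    have e1 : t % m = m - 1 := by omega
    have e2 : (t + 1) % m = 0 := by
      rw [Nat.add_mod, e1, Nat.mod_eq_of_lt (a := 1) (by omega), Nat.sub_add_cancel (by omega),
        Nat.mod_self]
    rw [e1, e2, hx0, hx1]
  have hmin1 : ∀ t, m ≤ t % m + 2 →
      2 * min (T.dist (w' t).1 (w' (t + 1)).1) (T.dist (w' (t + 1)).1 (w' (t + 2)).1)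
        ≤ T.diam := by
    intro t h
    have := hmlt t
    by_cases h1 : t % m + 1 = m
    · have := hwrap t h1
      omega
    · have h2 : (t + 1) % m = t % m + 1 := hsucc t 1 (by omega)
      have := hwrap (t + 1) (by omega)
      rw [show t + 1 + 1 = t + 2 by ring] at this
      omega
  refine core hT hn (congrArg (· * n) hm) w' hw' ?_ ?_ (fun t _ => hcol1 t) ?_ ?_ ?_ ?_
  · rw [hwx, Nat.zero_mod, hx0]
  · rw [hwx]
    have : (m * n - 1) % m = m - 1 := by
      obtain ⟨k, rfl⟩ : ∃ k, n = k + 1 := ⟨n - 1, by omega⟩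
      rw [show m * (k + 1) - 1 = m * k + (m - 1) by rw [Nat.mul_succ]; omega, Nat.mul_add_mod,
        Nat.mod_eq_of_lt (by omega)]
    rw [this, hx1]
  · intro t _
    rw [heps, hD' t (t + 1) (by omega)]
  · intro _ t _
    exact hD' t (t + 3) (by omega)
  · intro t _
    rw [heps]
    by_cases h : m ≤ t % m + 2
    · have := hmin1 t h
      omega
    · have e1 := hsucc t 1 (by omega)
      have e2 := hsucc t 2 (by omega)
      have d1 := hD' t (t + 1) (by omega)
      have d2 := hD' (t + 1) (t + 2) (by omega)
      rw [d1, d2, hwx, hwx, hwx, e1, e2]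
      rcases hxs (t % m + 1) (by omega) with ⟨-, h2⟩ | ⟨s, hs, h2⟩
      · rw [show t % m + 1 + 1 = t % m + 2 by ring] at h2
        omega
      · have : s = t % m := by omega
        subst this
        omega
  · intro t _ hv
    by_cases h : m ≤ t % m + 2
    · exact hmin1 t h
    · exact absurd hv (hcol2 t (by omega))

/-- Theorem 3.4, sufficient condition (d): if an ordering of
`V(T □ K_n)` satisfies (a)–(c) and
`min{d(u_{i_t},u_{i_{t+1}}), d(u_{i_{t+1}},u_{i_{t+2}})} ≤ (d + 1 − ε)/2` for all `t`,
then `rn(T □ K_n) = (mn−1)(d+ε) − 2nL(T)`. Halved quantities are multiplied by 2. -/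
theorem radioNumber_eq_of_min_dist {V : Type*} [Fintype V]
    (T : SimpleGraph V) (hT : T.IsTree) (m n : ℕ)
    (hm : Fintype.card V = m) (hd : 2 ≤ T.diam) (hn : 2 ≤ n)
    (w : ℕ → V × Fin n) (hw : Set.BijOn w (Set.Iio (m * n)) Set.univ)
    -- (a)
    (ha0 : level T (w 0).1 = 0) (ha1 : level T (w (m * n - 1)).1 = 0)
    -- (b)
    (hb : ∀ t, t + 1 < m * n → (w t).2 ≠ (w (t + 1)).2)
    -- (c)
    (hc : ∀ t, t + 1 < m * n →
      ((weightCenters T).ncard = 1 → InDifferentBranches T (w t).1 (w (t + 1)).1) ∧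
      ((weightCenters T).ncard = 2 → InOppositeBranches T (w t).1 (w (t + 1)).1))
    -- (d)
    (hmin : ∀ t, t + 2 < m * n →
      2 * min (T.dist (w t).1 (w (t + 1)).1) (T.dist (w (t + 1)).1 (w (t + 2)).1)
        ≤ T.diam + 1 - epsilon T) :
    (radioNumber (T □ (⊤ : SimpleGraph (Fin n))) : ℤ) =
      ((m * n : ℤ) - 1) * (T.diam + epsilon T) - 2 * n * totalLevel T := by
  rcases centers_cases hT with ⟨c, hW⟩ | ⟨p, q, hpq, hW⟩
  · have hcard : (weightCenters T).ncard = 1 := by rw [hW]; simp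
    have heps := epsilon_one hW
    rw [← hm] at *
    refine core hT hn rfl w hw ha0 ha1 hb ?_ (fun h => by omega) hmin ?_
    · intro t ht
      have h := (hc t ht).1 hcard
      unfold InDifferentBranches at h
      obtain ⟨y, hy⟩ := Set.ncard_eq_one.1 h
      have hy' : y ∈ {x ∈ weightCenters T | onPath T (w t).1 x (w (t + 1)).1} := by rw [hy]; simp
      obtain ⟨h1, h2⟩ := hy'
      rw [hW] at h1
      have h1 : y = c := h1
      subst h1
      unfold onPath at h2
      rw [heps, level_one hW, level_one hW, ← h2, T.dist_comm (u := y)]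
    · intro t ht _
      have := hmin t ht
      omega
  · have hcard := ncard_two hpq hW
    have heps := epsilon_two hpq hW
    have := two_centers hT hm hd hn hpq hW w hw ha0 ha1 hb (fun t ht => (hc t ht).2 hcard)
      (fun t ht => by have := hmin t ht; omega)
    rw [this, hm]

end RadioPaper
end

section
/- Let q ≥ 3 and n ≥ 4 be integers. Then rn(K_{1,q} □ K_n) = (q + 3)n − 3. -/
open SimpleGraph Finset

namespace RadioPaper

variable {V : Type*} [Fintype V]

/-- Distance in the star. -/
def starDist (q : ℕ) : Fin 1 ⊕ Fin q → Fin 1 ⊕ Fin q → ℕ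
  | .inl _, .inl _ => 0
  | .inl _, .inr _ => 1
  | .inr _, .inl _ => 1
  | .inr a, .inr b => if a = b then 0 else 2

theorem star_edist (q : ℕ) (x y : Fin 1 ⊕ Fin q) :
    (completeBipartiteGraph (Fin 1) (Fin q)).edist x y = (starDist q x y : ℕ∞) := by
  rcases x with x | x <;> rcases y with y | y
  · have : x = y := Subsingleton.elim _ _
    subst this
    simp [starDist]
  · simp [starDist]
  · simp [starDist]
  · by_cases h : x = y
    · subst h
      simp [starDist]
    · simp only [starDist, h, if_false]
      have := (edist_eq_two_iff (G := completeBipartiteGraph (Fin 1) (Fin q))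
        (u := Sum.inr x) (v := Sum.inr y)).2 ?_
      · exact_mod_cast this
      · refine ⟨by simpa using h, by simp, ⟨Sum.inl 0, ?_⟩⟩
        simp [SimpleGraph.mem_commonNeighbors]

theorem prod_edist (q n : ℕ) (x y : (Fin 1 ⊕ Fin q) × Fin n) :
    ((completeBipartiteGraph (Fin 1) (Fin q)) □ (⊤ : SimpleGraph (Fin n))).edist x y =
      ((starDist q x.1 y.1 + if x.2 = y.2 then 0 else 1 : ℕ) : ℕ∞) := by
  rw [edist_boxProd, star_edist, edist_top]
  push_cast
  rfl

theorem prod_dist (q n : ℕ) (x y : (Fin 1 ⊕ Fin q) × Fin n) :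
    ((completeBipartiteGraph (Fin 1) (Fin q)) □ (⊤ : SimpleGraph (Fin n))).dist x y =
      starDist q x.1 y.1 + if x.2 = y.2 then 0 else 1 := by
  rw [SimpleGraph.dist, prod_edist]
  rfl

theorem starDist_le (q : ℕ) (x y : Fin 1 ⊕ Fin q) : starDist q x y ≤ 2 := by
  rcases x with x | x <;> rcases y with y | y <;> simp [starDist]
  split_ifs <;> simp

theorem prod_diam (q n : ℕ) (hq : 3 ≤ q) (hn : 4 ≤ n) :
    ((completeBipartiteGraph (Fin 1) (Fin q)) □ (⊤ : SimpleGraph (Fin n))).diam = 3 := by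
  have h : ((completeBipartiteGraph (Fin 1) (Fin q)) □ (⊤ : SimpleGraph (Fin n))).ediam
      = ((3 : ℕ) : ℕ∞) := by
    apply le_antisymm
    · apply ediam_le_of_edist_le
      intro x y
      rw [prod_edist]
      have := starDist_le q x.1 y.1
      norm_cast
      split_ifs <;> omega
    · have := edist_le_ediam
        (G := (completeBipartiteGraph (Fin 1) (Fin q)) □ (⊤ : SimpleGraph (Fin n)))
        (u := (Sum.inr ⟨0, by omega⟩, ⟨0, by omega⟩)) (v := (Sum.inr ⟨1, by omega⟩, ⟨1, by omega⟩))
      rw [prod_edist] at this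
      simpa [starDist] using this
  rw [SimpleGraph.diam, h]
  rfl

/-- Radio condition made explicit. -/
theorem radio_iff (q n : ℕ) (hq : 3 ≤ q) (hn : 4 ≤ n) (f : (Fin 1 ⊕ Fin q) × Fin n → ℕ) :
    IsRadioLabelling ((completeBipartiteGraph (Fin 1) (Fin q)) □ (⊤ : SimpleGraph (Fin n))) f ↔
    ∀ u v, u ≠ v → 4 ≤ Nat.dist (f u) (f v) + (starDist q u.1 v.1 + if u.2 = v.2 then 0 else 1) := by
  unfold IsRadioLabelling
  simp only [prod_diam q n hq hn, prod_dist]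

theorem dist_le_spanOf {α : Type*} [Fintype α] (f : α → ℕ) (u v : α) :
    Nat.dist (f u) (f v) ≤ spanOf f :=
  Finset.le_sup (f := fun p : α × α => Nat.dist (f p.1) (f p.2)) (Finset.mem_univ (u, v))

theorem lower (q n : ℕ) (hq : 3 ≤ q) (hn : 4 ≤ n) (f : (Fin 1 ⊕ Fin q) × Fin n → ℕ)
    (hf : ∀ u v, u ≠ v →
      4 ≤ Nat.dist (f u) (f v) + (starDist q u.1 v.1 + if u.2 = v.2 then 0 else 1)) :
    (q + 3) * n ≤ spanOf f + 3 := by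
  have : Nonempty ((Fin 1 ⊕ Fin q) × Fin n) := ⟨(Sum.inl 0, ⟨0, by omega⟩)⟩
  obtain ⟨x0, hx0⟩ := Finite.exists_min f
  have hS : ∀ v, f v ≤ f x0 + spanOf f := by
    intro v
    have h1 := dist_le_spanOf f x0 v
    have h2 := hx0 v
    simp only [Nat.dist] at h1
    omega
  let g : (Fin n × Fin 3) ⊕ (Fin q × Fin n) → Fin (spanOf f + 3)
    | .inl p => ⟨f (Sum.inl 0, p.1) + p.2.val - f x0, by
        have := hS (Sum.inl 0, p.1); have := p.2.isLt; omega⟩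
    | .inr p => ⟨f (Sum.inr p.1, p.2) + 1 - f x0, by
        have := hS (Sum.inr p.1, p.2); omega⟩
  have hg : Function.Injective g := by
    rintro (⟨a, k⟩ | ⟨a, i⟩) (⟨b, l⟩ | ⟨b, j⟩) h <;> simp only [g, Fin.mk.injEq] at h
    · have ha := hx0 (Sum.inl 0, a)
      have hb := hx0 (Sum.inl 0, b)
      by_cases hab : a = b
      · subst hab
        have : k = l := by ext; omega
        rw [this]
      · have := hf (Sum.inl 0, a) (Sum.inl 0, b) (by simpa using hab)
        simp only [starDist, hab, if_false, Nat.dist] at this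
        omega
    · have ha := hx0 (Sum.inl 0, a)
      have hb := hx0 (Sum.inr b, j)
      have := hf (Sum.inl 0, a) (Sum.inr b, j) (by simp)
      simp only [starDist, Nat.dist] at this
      split_ifs at this <;> omega
    · have ha := hx0 (Sum.inr a, i)
      have hb := hx0 (Sum.inl 0, b)
      have := hf (Sum.inr a, i) (Sum.inl 0, b) (by simp)
      simp only [starDist, Nat.dist] at this
      split_ifs at this <;> omega
    · have ha := hx0 (Sum.inr a, i)
      have hb := hx0 (Sum.inr b, j)
      by_contra hne
      have := hf (Sum.inr a, i) (Sum.inr b, j) (by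
        intro h'
        apply hne
        simp only [Prod.mk.injEq, Sum.inr.injEq] at h'
        rw [h'.1, h'.2])
      simp only [starDist, Nat.dist] at this
      split_ifs at this <;> omega
  have := Fintype.card_le_of_injective g hg
  simp only [Fintype.card_sum, Fintype.card_prod, Fintype.card_fin] at this
  nlinarith

/-- Block number of the leaf copy `(a, i)`. -/
def blk (n a i : ℕ) : ℕ := if a % 2 = 0 then i else if 2 ≤ i then i - 2 else i + n - 2

/-- The optimal labelling. -/
def lab (q n : ℕ) : (Fin 1 ⊕ Fin q) × Fin n → ℕ
  | (.inl _, i) => if i.val = 0 then (q + 3) * n - 3 else 3 * (i.val - 1)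
  | (.inr a, i) => 3 * n - 4 + (a.val + q * blk n a i)

theorem blk_lt {n a i : ℕ} (hi : i < n) : blk n a i < n := by
  unfold blk
  split_ifs <;> omega

theorem leaf_bounds {q n a i : ℕ} (ha : a < q) (hi : i < n) : a + q * blk n a i + 1 ≤ q * n := by
  have h := blk_lt (a := a) hi
  have : q * (blk n a i + 1) ≤ q * n := Nat.mul_le_mul_left _ h
  rw [Nat.mul_add] at this
  omega

theorem leaf_first {q n a i : ℕ} (hn : 4 ≤ n) (h : a + q * blk n a i = 0) (hq : 3 ≤ q) :
    i = 0 := by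
  have h1 : a = 0 := by omega
  have h2 : q * blk n a i = 0 := by omega
  rcases Nat.mul_eq_zero.1 h2 with h3 | h3
  · omega
  · subst h1
    simpa [blk] using h3

theorem leaf_last {q n a i : ℕ} (hn : 4 ≤ n) (ha : a < q) (hi : i < n)
    (h : a + q * blk n a i + 1 = q * n) : i ≠ 0 := by
  rintro rfl
  have h1 : blk n a 0 + 2 ≤ n := by
    unfold blk
    split_ifs <;> omega
  have : q * (blk n a 0 + 2) ≤ q * n := Nat.mul_le_mul_left _ h1
  rw [Nat.mul_add] at this
  omega

theorem leaf_leaf {q n a i b j : ℕ} (hq : 3 ≤ q) (hn : 4 ≤ n) (ha : a < q) (hb : b < q)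
    (hi : i < n) (hj : j < n) (hne : ¬ (a = b ∧ i = j))
    (hle : a + q * blk n a i ≤ b + q * blk n b j) :
    a + q * blk n a i + (if a = b then 3 else if i = j then 2 else 1) ≤ b + q * blk n b j := by
  rcases lt_trichotomy (blk n a i) (blk n b j) with h | h | h
  · rcases Nat.lt_or_ge (blk n a i + 1) (blk n b j) with h' | h'
    · have : q * (blk n a i + 2) ≤ q * blk n b j := Nat.mul_le_mul_left _ h'
      rw [Nat.mul_add] at this
      split_ifs <;> omega
    · have h2 : blk n b j = blk n a i + 1 := by omega
      have h3 : q * blk n b j = q * blk n a i + q := by rw [h2]; ring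
      rw [h3]
      split_ifs with h4 h5
      · omega
      · have : ¬ (b + q = a + 1) := by
          intro h6
          have hb0 : b = 0 := by omega
          subst hb0 h5
          unfold blk at h2
          split_ifs at h2 <;> omega
        omega
      · omega
  · rw [h]
    have h0 : a ≤ b := by
      rw [h] at hle
      omega
    split_ifs with h4 h5
    · exfalso
      apply hne
      subst h4
      refine ⟨rfl, ?_⟩
      unfold blk at h
      split_ifs at h <;> omega
    · have : b ≠ a + 1 := by
        rintro rfl
        subst h5
        unfold blk at h
        split_ifs at h <;> omega
      omega
    · omega
  · have : q * (blk n b j + 1) ≤ q * blk n a i := Nat.mul_le_mul_left _ h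
    rw [Nat.mul_add] at this
    exfalso
    omega

theorem center_leaf (q n : ℕ) (hq : 3 ≤ q) (hn : 4 ≤ n) (c : Fin 1) (i : Fin n) (b : Fin q)
    (j : Fin n) :
    (if i = j then 3 else 2) ≤ Nat.dist (lab q n (.inl c, i)) (lab q n (.inr b, j)) := by
  have h1 := leaf_bounds b.isLt j.isLt
  have h2 := fun h => leaf_first (q := q) (a := b) (i := j) hn h hq
  have h3 := leaf_last hn b.isLt j.isLt
  have hi := i.isLt
  simp only [lab, Nat.dist, Fin.ext_iff, Nat.add_mul]
  generalize (b : ℕ) + q * blk n b j = t at *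
  generalize q * n = M at *
  split_ifs <;> omega

theorem center_center (q n : ℕ) (hq : 3 ≤ q) (hn : 4 ≤ n) (c d : Fin 1) (i j : Fin n)
    (h : i ≠ j) : 3 ≤ Nat.dist (lab q n (.inl c, i)) (lab q n (.inl d, j)) := by
  have hi := i.isLt
  have hj := j.isLt
  have hqn : 3 * n ≤ q * n := Nat.mul_le_mul_right _ hq
  simp only [lab, Nat.dist, Nat.add_mul]
  rw [Ne, Fin.ext_iff] at h
  generalize q * n = M at *
  split_ifs <;> omega

theorem lab_radio (q n : ℕ) (hq : 3 ≤ q) (hn : 4 ≤ n) (u v : (Fin 1 ⊕ Fin q) × Fin n)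
    (huv : u ≠ v) : 4 ≤ Nat.dist (lab q n u) (lab q n v) +
      (starDist q u.1 v.1 + if u.2 = v.2 then 0 else 1) := by
  obtain ⟨a | a, i⟩ := u <;> obtain ⟨b | b, j⟩ := v
  · have hij : i ≠ j := by
      rintro rfl
      exact huv (by rw [Subsingleton.elim a b])
    have := center_center q n hq hn a b i j hij
    simp only [starDist, hij, if_false]
    omega
  · have := center_leaf q n hq hn a i b j
    simp only [starDist]
    split_ifs at * <;> omega
  · have := center_leaf q n hq hn b j a i
    rw [Nat.dist_comm] at this
    simp only [starDist, eq_comm (a := i)]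
    split_ifs at * <;> omega
  · have hne : ¬ ((a : ℕ) = b ∧ (i : ℕ) = j) := by
      rintro ⟨h1, h2⟩
      exact huv (by rw [Fin.ext h1, Fin.ext h2])
    have h1 := leaf_leaf hq hn a.isLt b.isLt i.isLt j.isLt hne
    have h2 := leaf_leaf hq hn b.isLt a.isLt j.isLt i.isLt (fun h => hne ⟨h.1.symm, h.2.symm⟩)
    simp only [eq_comm (a := (b : ℕ)), eq_comm (a := (j : ℕ))] at h2
    simp only [starDist, lab, Nat.dist, Fin.ext_iff]
    generalize (a : ℕ) + q * blk n a i = s at *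
    generalize (b : ℕ) + q * blk n b j = t at *
    split_ifs at * <;> omega

theorem lab_le (q n : ℕ) (hq : 3 ≤ q) (hn : 4 ≤ n) (u : (Fin 1 ⊕ Fin q) × Fin n) :
    lab q n u ≤ (q + 3) * n - 3 := by
  have hqn : 3 * n ≤ q * n := Nat.mul_le_mul_right _ hq
  obtain ⟨a | a, i⟩ := u
  · have hi := i.isLt
    simp only [lab, Nat.add_mul]
    split_ifs <;> omega
  · have := leaf_bounds a.isLt i.isLt
    simp only [lab, Nat.add_mul]
    omega

/-- `rn(K_{1,q} □ K_n) = (q + 3)n − 3` for `q ≥ 3`, `n ≥ 4`.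
The star `K_{1,q}` is realized as the complete bipartite graph with parts of sizes
`1` and `q`. -/
theorem radioNumber_star_boxProd_complete (q n : ℕ) (hq : 3 ≤ q) (hn : 4 ≤ n) :
    radioNumber ((completeBipartiteGraph (Fin 1) (Fin q)) □ (⊤ : SimpleGraph (Fin n))) =
      (q + 3) * n - 3 := by
  have hmem : spanOf (lab q n) ∈ { k | ∃ f : (Fin 1 ⊕ Fin q) × Fin n → ℕ, IsRadioLabelling
      ((completeBipartiteGraph (Fin 1) (Fin q)) □ (⊤ : SimpleGraph (Fin n))) f ∧ spanOf f = k } :=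
    ⟨lab q n, (radio_iff q n hq hn _).2 (lab_radio q n hq hn), rfl⟩
  apply le_antisymm
  · refine (Nat.sInf_le hmem).trans ?_
    apply Finset.sup_le
    rintro ⟨u, v⟩ -
    have h1 := lab_le q n hq hn u
    have h2 := lab_le q n hq hn v
    simp only [Nat.dist]
    omega
  · obtain ⟨f, hf, hk⟩ := Nat.sInf_mem ⟨_, hmem⟩
    have := lower q n hq hn f ((radio_iff q n hq hn _).1 hf)
    unfold radioNumber
    rw [← hk]
    omega

end RadioPaper
end

section
/- Let m ≥ 4 be an odd integer and n ≥ 3 an integer, and let P_m be the path on m vertices. Then rn(P_m □ K_n) > (m²n − 2m + n)/2; that is, the general lower bound (mn − 1)(d + ε) − 2nL(T) for rn(T □ K_n) is not attained when T = P_m with m odd. -/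
open SimpleGraph Finset

namespace RadioPaper

variable {V : Type*} [Fintype V]

lemma abs_sum (k : ℕ) : ∑ a ∈ Finset.range (2 * k + 1), |(a : ℤ) - k| = k * (k + 1) := by
  induction k with
  | zero => simp
  | succ k ih =>
    have e : 2 * (k + 1) + 1 = (2 * k + 1 + 1) + 1 := by ring
    rw [e, Finset.sum_range_succ', Finset.sum_range_succ]
    have h : ∀ a : ℕ, ((a + 1 : ℕ) : ℤ) - ((k + 1 : ℕ) : ℤ) = (a : ℤ) - k := by
      intro a; push_cast; ring
    simp only [h, ih]
    have h1 : |((2 * k + 1 : ℕ) : ℤ) - k| = k + 1 := by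
      rw [abs_of_nonneg] <;> push_cast <;> linarith
    have h2 : |((0 : ℕ) : ℤ) - ((k + 1 : ℕ) : ℤ)| = k + 1 := by
      rw [abs_of_nonpos] <;> push_cast <;> linarith
    rw [h1, h2]; push_cast; ring

/-- The combinatorial core: an ordering of the vertices by label. -/
lemma core_s17 (k n M : ℕ) (hk : 1 ≤ k) (hN : M + 1 = (2 * k + 1) * n)
    (x t : ℕ → ℤ)
    (hx : ∀ i ≤ M, |x i| ≤ k)
    (ht : ∀ i j, i < j → j ≤ M → (2 * k + 1 : ℤ) ≤ t j - t i + |x i - x j|)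
    (hg : ∀ g : ℤ → ℤ, ∑ i ∈ Finset.range (M + 1), g (x i)
      = n * ∑ a ∈ Finset.range (2 * k + 1), g ((a : ℤ) - k))
    (hs : t M - t 0 ≤ M * (2 * k + 1) - 2 * (n * (k * (k + 1)))) : False := by
  have hL := hg (fun z => |z|)
  rw [abs_sum] at hL
  set s : ℕ → ℤ := fun i => t (i + 1) - t i - ((2 * k + 1) - |x i| - |x (i + 1)|) with hsdef
  have hs0 : ∀ i ∈ Finset.range M, 0 ≤ s i := by
    intro i hi
    have hi := Finset.mem_range.1 hi
    have h1 := ht i (i + 1) (by omega) (by omega)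
    have h2 := abs_sub (x i) (x (i + 1))
    simp only [hsdef]; linarith
  have hsum : ∑ i ∈ Finset.range M, s i
      = t M - t 0 - M * (2 * k + 1) + 2 * (n * (k * (k + 1))) - |x 0| - |x M| := by
    have e1 := Finset.sum_range_succ (fun i => |x i|) M
    have e2 := Finset.sum_range_succ' (fun i => |x i|) M
    have e3 := Finset.sum_range_sub t M
    have : ∑ i ∈ Finset.range M, s i = ∑ i ∈ Finset.range M, (t (i + 1) - t i)
        - M * (2 * k + 1) + ∑ i ∈ Finset.range M, |x i| + ∑ i ∈ Finset.range M, |x (i + 1)| := by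
      simp only [hsdef, Finset.sum_sub_distrib, Finset.sum_const, Finset.card_range, nsmul_eq_mul]
      ring
    rw [this]; linarith
  have hsn := Finset.sum_nonneg hs0
  have a0 := abs_nonneg (x 0)
  have aM := abs_nonneg (x M)
  have hx0 : x 0 = 0 := abs_eq_zero.1 (by linarith)
  have hxM : x M = 0 := abs_eq_zero.1 (by linarith)
  have hsz : ∀ i < M, s i = 0 := by
    intro i hi
    exact (Finset.sum_eq_zero_iff_of_nonneg hs0).1 (by linarith) i (Finset.mem_range.2 hi)
  -- every vertex of level `k` is next to a central vertex
  have key : ∀ i, i + 2 ≤ M → |x (i + 1)| = k → x i = 0 ∨ x (i + 2) = 0 := by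
    intro i hi hxi
    have h1 := hsz i (by omega)
    have h2 := hsz (i + 1) (by omega)
    have t1 := ht i (i + 1) (by omega) (by omega)
    have t2 := ht (i + 1) (i + 2) (by omega) (by omega)
    have t3 := ht i (i + 2) (by omega) (by omega)
    simp only [hsdef, add_assoc, Nat.reduceAdd] at h1 h2
    have hk' : (1 : ℤ) ≤ k := by exact_mod_cast hk
    by_contra! hne
    obtain ⟨hne1, hne2⟩ := hne
    generalize x i = p at *
    generalize x (i + 1) = q at *
    generalize x (i + 2) = r at *
    clear hg hL hsum hx ht hs0 hsz hs hsdef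
    simp only [abs_eq_max_neg] at *
    omega
  classical
  set Z := (Finset.range (M + 1)).filter (fun i => x i = 0) with hZ
  set A := (Finset.range (M + 1)).filter (fun i => |x i| = k) with hA
  have hZc : (Z.card : ℤ) = n := by
    have := hg (fun z => if z = 0 then 1 else 0)
    rw [hZ, Finset.card_filter]; push_cast
    rw [this, Finset.sum_eq_single k] <;> simp
    all_goals first | omega | (intros; omega)
  have hAc : (A.card : ℤ) = n * 2 := by
    have := hg (fun z => if |z| = k then 1 else 0)
    rw [hA, Finset.card_filter]; push_cast
    rw [this, ← Finset.sum_filter]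
    have : (Finset.range (2 * k + 1)).filter (fun a => |((a : ℕ) : ℤ) - k| = k) = {0, 2 * k} := by
      ext a
      simp only [Finset.mem_filter, Finset.mem_range, Finset.mem_insert, Finset.mem_singleton]
      rw [abs_eq_max_neg]
      omega
    rw [this, Finset.sum_pair (by omega)]; norm_num
  have hsub : A ⊆ (Z.erase M).image (fun i => i + 1) ∪ (Z.erase 0).image (fun i => i - 1) := by
    intro i hi
    simp only [hA, Finset.mem_filter, Finset.mem_range] at hi
    obtain ⟨hi, hik⟩ := hi
    have i0 : i ≠ 0 := by rintro rfl; rw [hx0] at hik; simp at hik; omega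
    have iM : i ≠ M := by rintro rfl; rw [hxM] at hik; simp at hik; omega
    obtain ⟨j, rfl⟩ := Nat.exists_eq_succ_of_ne_zero i0
    simp only [Finset.mem_union, Finset.mem_image, Finset.mem_erase, hZ, Finset.mem_filter,
      Finset.mem_range]
    rcases key j (by omega) hik with h | h
    · left; exact ⟨j, ⟨by omega, by omega, h⟩, rfl⟩
    · right; exact ⟨j + 2, ⟨by omega, by omega, h⟩, by omega⟩
  have c1 := Finset.card_le_card hsub
  have c2 := Finset.card_union_le ((Z.erase M).image (fun i => i + 1))
    ((Z.erase 0).image (fun i => i - 1))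
  have c3 := Finset.card_image_le (s := Z.erase M) (f := fun i => i + 1)
  have c4 := Finset.card_image_le (s := Z.erase 0) (f := fun i => i - 1)
  have m0 : 0 ∈ Z := by simp [hZ, hx0]
  have mM : M ∈ Z := by simp [hZ, hxM]
  rw [Finset.card_erase_of_mem mM] at c3
  rw [Finset.card_erase_of_mem m0] at c4
  have := Finset.card_pos.2 ⟨0, m0⟩
  omega

lemma path_walk_le {m : ℕ} {u v : Fin m} (p : (pathGraph m).Walk u v) :
    Nat.dist u.1 v.1 ≤ p.length := by
  induction p with
  | nil => simp [Nat.dist_self]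
  | cons h p ih =>
    rw [pathGraph_adj] at h
    simp only [Walk.length_cons]
    simp only [Nat.dist] at *
    omega

lemma path_connected {m : ℕ} (hm : 1 ≤ m) : (pathGraph m).Connected := by
  obtain ⟨j, rfl⟩ := Nat.exists_eq_add_of_le' hm
  exact pathGraph_connected j

lemma path_dist_le {m : ℕ} (hm : 1 ≤ m) (j : ℕ) : ∀ (u v : Fin m), v.1 = u.1 + j →
    (pathGraph m).dist u v ≤ j := by
  induction j with
  | zero =>
    intro u v h
    have : u = v := Fin.ext (by omega)
    subst this; simp
  | succ j ih =>
    intro u v h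
    have hv := v.2
    have h1 := ih u ⟨u.1 + j, by omega⟩ rfl
    have h2 := (path_connected hm).dist_triangle (u := u) (v := ⟨u.1 + j, by omega⟩) (w := v)
    have h3 : (pathGraph m).dist ⟨u.1 + j, by omega⟩ v = 1 := by
      rw [dist_eq_one_iff_adj, pathGraph_adj]; left; simp; omega
    omega

lemma path_dist {m : ℕ} (hm : 1 ≤ m) (u v : Fin m) :
    (pathGraph m).dist u v = Nat.dist u.1 v.1 := by
  apply le_antisymm
  · rcases le_total u.1 v.1 with h | h
    · have := path_dist_le hm (v.1 - u.1) u v (by omega)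
      simp only [Nat.dist]; omega
    · rw [SimpleGraph.dist_comm]
      have := path_dist_le hm (u.1 - v.1) v u (by omega)
      simp only [Nat.dist]; omega
  · obtain ⟨p, hp⟩ := (path_connected hm).exists_walk_length_eq_dist u v
    rw [← hp]; exact path_walk_le p

lemma box_dist {m n : ℕ} (hm : 1 ≤ m) (hn : 1 ≤ n) (u v : Fin m × Fin n) :
    ((pathGraph m) □ (⊤ : SimpleGraph (Fin n))).dist u v
      = Nat.dist u.1.1 v.1.1 + (if u.2 = v.2 then 0 else 1) := by
  haveI : Nonempty (Fin n) := ⟨⟨0, hn⟩⟩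
  have h1 := path_connected hm
  have h2 : (⊤ : SimpleGraph (Fin n)).Connected := connected_top
  rw [← path_dist hm, ← dist_top, ← Nat.cast_inj (R := ℕ∞)]
  push_cast
  rw [(h1 _ _).coe_dist_eq_edist, (h2 _ _).coe_dist_eq_edist,
    ((h1.boxProd h2) _ _).coe_dist_eq_edist, edist_boxProd]

lemma box_diam {m n : ℕ} (hm : 1 ≤ m) (hn : 2 ≤ n) :
    m ≤ ((pathGraph m) □ (⊤ : SimpleGraph (Fin n))).diam := by
  haveI : Nonempty (Fin n) := ⟨⟨0, by omega⟩⟩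
  haveI : Nonempty (Fin m) := ⟨⟨0, by omega⟩⟩
  have hc : ((pathGraph m) □ (⊤ : SimpleGraph (Fin n))).Connected :=
    (path_connected hm).boxProd connected_top
  have := dist_le_diam (connected_iff_ediam_ne_top.1 hc)
    (u := (⟨0, by omega⟩, ⟨0, by omega⟩)) (v := (⟨m - 1, by omega⟩, ⟨1, by omega⟩))
  rw [box_dist hm (by omega)] at this
  simp [Nat.dist] at this
  omega

lemma exists_labelling {α : Type*} [Fintype α] (G : SimpleGraph α) :
    ∃ f : α → ℕ, IsRadioLabelling G f := by
  let e := Fintype.equivFin α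
  refine ⟨fun a => (G.diam + 1) * (e a).1, ?_⟩
  intro u v huv
  have : (e u).1 ≠ (e v).1 := fun h => huv (e.injective (Fin.ext h))
  rw [Nat.dist_mul_left]
  have : 1 ≤ Nat.dist (e u).1 (e v).1 := by simp only [Nat.dist]; omega
  nlinarith

lemma span_gt (k n : ℕ) (hk : 1 ≤ k) (hn : 2 ≤ n) (f : Fin (2 * k + 1) × Fin n → ℕ)
    (hf : IsRadioLabelling ((pathGraph (2 * k + 1)) □ (⊤ : SimpleGraph (Fin n))) f) :
    (2 * k + 1) ^ 2 * n + n < 2 * spanOf f + 2 * (2 * k + 1) := by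
  have hd := box_diam (m := 2 * k + 1) (n := n) (by omega) hn
  have hf' : ∀ u v, u ≠ v → 2 * k + 1 ≤ Nat.dist (f u) (f v) + Nat.dist u.1.1 v.1.1 := by
    intro u v huv
    have := hf u v huv
    rw [box_dist (by omega) (by omega)] at this
    split_ifs at this <;> omega
  obtain ⟨M, hM⟩ : ∃ M, M + 1 = (2 * k + 1) * n :=
    ⟨(2 * k + 1) * n - 1, Nat.sub_add_cancel (by nlinarith)⟩
  have hcard : Fintype.card (Fin (2 * k + 1) × Fin n) = M + 1 := by simp [hM]
  let e := (Fintype.equivFinOfCardEq hcard).symm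
  let u : Fin (M + 1) ≃ Fin (2 * k + 1) × Fin n := (Tuple.sort (f ∘ e)).trans e
  have hmono : Monotone (fun i => f (u i)) := Tuple.monotone_sort (f ∘ e)
  let w : ℕ → Fin (2 * k + 1) × Fin n := fun i => u (Fin.ofNat (M + 1) i)
  have hw : ∀ i (h : i < M + 1), w i = u ⟨i, h⟩ := by
    intro i h
    simp only [w]; congr 1; apply Fin.ext; simp [Fin.ofNat, Nat.mod_eq_of_lt h]
  by_contra hcon
  refine core_s17 k n M hk hM (fun i => ((w i).1.1 : ℤ) - k) (fun i => (f (w i) : ℤ)) ?_ ?_ ?_ ?_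
  · intro i _
    have := (w i).1.2
    rw [abs_le]; constructor <;> omega
  · intro i j hij hj
    have hne : w i ≠ w j := by
      rw [hw i (by omega), hw j (by omega)]
      intro h
      have := congrArg Fin.val (u.injective h)
      simp at this; omega
    have hle : f (w i) ≤ f (w j) := by
      rw [hw i (by omega), hw j (by omega)]
      exact hmono (Fin.mk_le_mk.2 hij.le)
    have := hf' _ _ hne
    simp only [Nat.dist, abs_eq_max_neg] at *
    omega
  · intro g
    rw [← Fin.sum_univ_eq_sum_range (fun i => g (((w i).1.1 : ℤ) - k)),
      ← Fin.sum_univ_eq_sum_range (fun a => g ((a : ℤ) - k))]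
    have : ∀ i : Fin (M + 1), w i.1 = u i := fun i => hw i.1 i.2
    simp only [this]
    rw [Equiv.sum_comp u (fun v => g ((v.1.1 : ℤ) - k)), Fintype.sum_prod_type]
    simp [Finset.mul_sum]
  · have hsp : Nat.dist (f (w 0)) (f (w M)) ≤ spanOf f :=
      Finset.le_sup (f := fun p : (Fin (2 * k + 1) × Fin n) × (Fin (2 * k + 1) × Fin n) =>
        Nat.dist (f p.1) (f p.2)) (Finset.mem_univ (w 0, w M))
    have h1 : (f (w M) : ℤ) - f (w 0) ≤ spanOf f := by
      simp only [Nat.dist] at hsp; omega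
    have hM' : (M : ℤ) = (2 * k + 1) * n - 1 := by
      have : ((M + 1 : ℕ) : ℤ) = ((2 * k + 1) * n : ℕ) := by rw [hM]
      push_cast at this; linarith
    have hcon' : (2 * (spanOf f : ℤ) + 2 * (2 * k + 1)) ≤ (2 * k + 1) ^ 2 * n + n := by
      exact_mod_cast not_lt.1 hcon
    rw [hM']
    show (f (w M) : ℤ) - f (w 0) ≤ _
    nlinarith

/-- for odd `m ≥ 4` and `n ≥ 3`,
`rn(P_m □ K_n) > (m²n − 2m + n)/2`, i.e. the general lower bound
`(mn − 1)(d + ε) − 2nL(T)` is not attained for `T = P_m` with `m` odd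
(stated with both sides doubled). -/
theorem radioNumber_path_boxProd_complete_odd_gt (m n : ℕ)
    (hm : 4 ≤ m) (hmo : Odd m) (hn : 3 ≤ n) :
    m ^ 2 * n - 2 * m + n <
      2 * radioNumber ((SimpleGraph.pathGraph m) □ (⊤ : SimpleGraph (Fin n))) := by
  obtain ⟨k, rfl⟩ := hmo
  obtain ⟨f, hf, hs⟩ : radioNumber ((pathGraph (2 * k + 1)) □ (⊤ : SimpleGraph (Fin n))) ∈
      { l | ∃ f : Fin (2 * k + 1) × Fin n → ℕ,
        IsRadioLabelling ((pathGraph (2 * k + 1)) □ (⊤ : SimpleGraph (Fin n))) f ∧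
          spanOf f = l } := by
    apply Nat.sInf_mem
    obtain ⟨f, hf⟩ := exists_labelling ((pathGraph (2 * k + 1)) □ (⊤ : SimpleGraph (Fin n)))
    exact ⟨_, f, hf, rfl⟩
  have := span_gt k n (by omega) (by omega) f hf
  rw [← hs]
  have h2 : 2 * (2 * k + 1) ≤ (2 * k + 1) ^ 2 * n := by nlinarith
  omega

end RadioPaper
end
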